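/- arXiv:1008.0305 — 3 statements merged into one kernel-verified Lean document; each statement's English description precedes it below -/
import Mathlib

section
/- Let p be a prime, let A be a commutative ring with pA = 0 equipped with a proper pseudovaluation ν which is moreover a valuation, and let ε > 0. Then for all ξ, η ∈ W(A) with γ_ε(ξ) ≠ −∞ and γ_ε(η) ≠ −∞, one has the equality γ_ε(ξη) = γ_ε(ξ) + γ_ε(η). -/
open scoped Classical

noncomputable section

/-- A pseudovaluation on a commutative ring `A`: a function `ν : A → ℝ ∪ {±∞}` with
`ν 0 = ∞`, `ν 1 = 0`, `ν (a - b) ≥ min (ν a) (ν b)`, and `ν (a*b) ≥ ν a + ν b`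
whenever `ν a ≠ -∞` and `ν b ≠ -∞`. -/
structure IsPseudovaluation {A : Type*} [CommRing A] (ν : A → EReal) : Prop where
  map_zero : ν 0 = ⊤
  map_one : ν 1 = 0
  min_le_sub : ∀ a b : A, min (ν a) (ν b) ≤ ν (a - b)
  add_le_mul : ∀ a b : A, ν a ≠ ⊥ → ν b ≠ ⊥ → ν a + ν b ≤ ν (a * b)

/-- A proper pseudovaluation never takes the value `-∞`. -/
def IsProperPV {A : Type*} [CommRing A] (ν : A → EReal) : Prop :=
  IsPseudovaluation ν ∧ ∀ a : A, ν a ≠ ⊥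

/-- A negative pseudovaluation is proper and satisfies `ν a ≤ 0` for `a ≠ 0`. -/
def IsNegativePV {A : Type*} [CommRing A] (ν : A → EReal) : Prop :=
  IsPseudovaluation ν ∧ (∀ a : A, ν a ≠ ⊥) ∧ ∀ a : A, a ≠ 0 → ν a ≤ 0

/-- `f` is localizing with respect to `ν` if there are `C > 0`, `D ≥ 0` with
`ν (fⁿ x) ≤ C · ν x + n D` for all `n` and `x`. -/
def IsLocalizing {A : Type*} [CommRing A] (ν : A → EReal) (f : A) : Prop :=
  ∃ C D : ℝ, 0 < C ∧ 0 ≤ D ∧ ∀ (n : ℕ) (x : A),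
    ν (f ^ n * x) ≤ (C : EReal) * ν x + (((n : ℝ) * D : ℝ) : EReal)

/-- Two functions `A → ℝ ∪ {±∞}` are linearly equivalent if they dominate each other
up to positive multiplicative and nonnegative additive constants. -/
def LinearlyEquivalent {A : Type*} (ν₁ ν₂ : A → EReal) : Prop :=
  ∃ c₁ c₂ d₁ d₂ : ℝ, 0 < c₁ ∧ 0 < c₂ ∧ 0 ≤ d₁ ∧ 0 ≤ d₂ ∧
    (∀ a : A, (c₂ : EReal) * ν₂ a - (d₂ : EReal) ≤ ν₁ a) ∧
    (∀ a : A, (c₁ : EReal) * ν₁ a - (d₁ : EReal) ≤ ν₂ a)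

/-- The weighted degree pseudovaluation on a multivariate polynomial ring:
`ν (Σ_k c_k T^k) = inf_k { μ(c_k) - Σ_i k_i d_i }`. -/
def weightedDegPV {R : Type*} [CommRing R] (μ : R → EReal) {m : ℕ} (d : Fin m → ℝ)
    (f : MvPolynomial (Fin m) R) : EReal :=
  ⨅ k : Fin m →₀ ℕ, (μ (MvPolynomial.coeff k f) - ((∑ i, (k i : ℝ) * d i : ℝ) : EReal))

/-- A pseudovaluation `τ` on an `R`-algebra `B` is admissible (relative to `μ` on `R`)
if it is the quotient of a weighted degree pseudovaluation under some surjection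
from a polynomial ring. -/
def IsAdmissiblePV {R B : Type*} [CommRing R] [CommRing B] [Algebra R B]
    (μ : R → EReal) (τ : B → EReal) : Prop :=
  ∃ (m : ℕ) (π : MvPolynomial (Fin m) R →ₐ[R] B) (d : Fin m → ℝ),
    Function.Surjective π ∧ (∀ i, 0 < d i) ∧
    ∀ b : B, τ b = ⨆ (f : MvPolynomial (Fin m) R) (_ : π f = b), weightedDegPV μ d f

/-- The pseudovaluation `μ (Σ_i a_i X^i) = min_i { ν(a_i) - i·d }` on `A[X]`. -/
def polyPV {A : Type*} [CommRing A] (ν : A → EReal) (d : ℝ) (g : Polynomial A) : EReal :=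
  ⨅ i : ℕ, (ν (g.coeff i) - (((i : ℝ) * d : ℝ) : EReal))

/-- The induced pseudovaluation on the localization `A_f`: the quotient of `polyPV ν d`
under the map `A[X] → A_f`, `X ↦ f⁻¹`. -/
def locPV {A : Type*} [CommRing A] (ν : A → EReal) (f : A) (d : ℝ)
    (z : Localization.Away f) : EReal :=
  ⨆ (g : Polynomial A)
    (_ : Polynomial.aeval (IsLocalization.Away.invSelf (S := Localization.Away f) f) g = z),
    polyPV ν d g

/-- The Gauss norm `γ_ε(α) = inf_i { i + ε p^{-i} ν(a_i) }` of a Witt vector. -/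
def gaussNorm (p : ℕ) {A : Type*} [CommRing A] (ν : A → EReal) (ε : ℝ)
    (α : WittVector p A) : EReal :=
  ⨅ i : ℕ, ((i : EReal) + ((ε * (p : ℝ) ^ (-(i : ℤ)) : ℝ) : EReal) * ν (α.coeff i))

/-- A Witt vector is overconvergent if `γ_ε(α) ≠ -∞` for some `ε > 0`. -/
def IsOverconvergent (p : ℕ) {A : Type*} [CommRing A] (ν : A → EReal)
    (α : WittVector p A) : Prop :=
  ∃ ε : ℝ, 0 < ε ∧ gaussNorm p ν ε α ≠ ⊥

/-- The trivial valuation on an integral domain: `ν 0 = ∞` and `ν a = 0` for `a ≠ 0`. -/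
def trivialPV (K : Type*) [Zero K] : K → EReal :=
  fun a => if a = 0 then (⊤ : EReal) else 0

section StructurePolynomial

open MvPolynomial

variable {p : ℕ} [Fact p.Prime]

/-- The polynomials computing differences of Witt vectors are homogeneous of degree `p ^ n`
when the `i`-th components are given weight `p ^ i`. -/
theorem isWeightedHomogeneous_wittSub (n : ℕ) :
    IsWeightedHomogeneous (fun b : Fin 2 × ℕ => p ^ b.2) (WittVector.wittSub p n) (p ^ n) := by
  have hW : ∀ (b : Fin 2) (n : ℕ), IsWeightedHomogeneous (fun b : Fin 2 × ℕ => p ^ b.2)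
      (rename (fun i => (b, i)) (wittPolynomial p ℚ n)) (p ^ n) := by
    intro b n
    rw [wittPolynomial_eq_sum_C_mul_X_pow, map_sum]
    refine IsWeightedHomogeneous.sum _ _ _ fun i hi => ?_
    have hi' : i ≤ n := Nat.lt_succ_iff.mp (Finset.mem_range.mp hi)
    have h := (isWeightedHomogeneous_C (fun b : Fin 2 × ℕ => p ^ b.2) ((p : ℚ) ^ i)).mul
      ((isWeightedHomogeneous_X ℚ (fun b : Fin 2 × ℕ => p ^ b.2) (b, i)).pow (p ^ (n - i)))
    have he : 0 + p ^ (n - i) • p ^ i = p ^ n := by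
      rw [zero_add, smul_eq_mul, ← pow_add, Nat.sub_add_cancel hi']
    rw [he] at h
    simpa using h
  have hS : ∀ n : ℕ, IsWeightedHomogeneous (fun b : Fin 2 × ℕ => p ^ b.2)
      (wittStructureRat p (X 0 - X 1 : MvPolynomial (Fin 2) ℚ) n) (p ^ n) := by
    intro n
    induction n using Nat.strong_induction_on with
    | _ n ih =>
      rw [wittStructureRat_rec]
      have hd : IsWeightedHomogeneous (fun b : Fin 2 × ℕ => p ^ b.2)
          (bind₁ (fun b => rename (fun i => (b, i)) (wittPolynomial p ℚ n))
            (X 0 - X 1 : MvPolynomial (Fin 2) ℚ) -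
            ∑ i ∈ Finset.range n, C ((p : ℚ) ^ i) *
              wittStructureRat p (X 0 - X 1 : MvPolynomial (Fin 2) ℚ) i ^ p ^ (n - i))
          (p ^ n) := by
        refine IsWeightedHomogeneous.sub ?_ (IsWeightedHomogeneous.sum _ _ _ fun i hi => ?_)
        · simpa using (hW 0 n).sub (hW 1 n)
        · have hi' := Finset.mem_range.mp hi
          have h := (isWeightedHomogeneous_C (fun b : Fin 2 × ℕ => p ^ b.2) ((p : ℚ) ^ i)).mul
            ((ih i hi').pow (p ^ (n - i)))
          have he : 0 + p ^ (n - i) • p ^ i = p ^ n := by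
            rw [zero_add, smul_eq_mul, ← pow_add, Nat.sub_add_cancel hi'.le]
          rwa [he] at h
      simpa using (isWeightedHomogeneous_C (fun b : Fin 2 × ℕ => p ^ b.2) (1 / (p : ℚ) ^ n)).mul hd
  intro d hd
  refine hS n (d := d) ?_
  have h := map_wittStructureInt p (X 0 - X 1 : MvPolynomial (Fin 2) ℤ) n
  simp only [map_sub, map_X] at h
  rw [← h, coeff_map]
  exact (map_ne_zero_iff (Int.castRingHom ℚ) Int.cast_injective).mpr hd

end StructurePolynomial

namespace IsPseudovaluation

variable {A : Type*} [CommRing A] {ν : A → EReal}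

/-- The elements of pseudovaluation at least `r`. -/
def lowerBoundAddSubgroup (hν : IsPseudovaluation ν) (r : EReal) : AddSubgroup A :=
  AddSubgroup.ofSub {a | r ≤ ν a} ⟨0, by simp [hν.map_zero]⟩
    fun x hx y hy => by
      rw [← sub_eq_add_neg]
      exact (le_min hx hy).trans (hν.min_le_sub x y)

theorem mem_lowerBoundAddSubgroup (hν : IsPseudovaluation ν) {r : EReal} {a : A} :
    a ∈ hν.lowerBoundAddSubgroup r ↔ r ≤ ν a := Iff.rfl

end IsPseudovaluation

section Multiplicative

variable {A : Type*} [CommRing A] {ν : A → EReal}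

theorem natCast_mul_le_map_pow (h1 : ν 1 = 0) (hval : ∀ a b : A, ν (a * b) = ν a + ν b)
    {a : A} {r : ℝ} (h : (r : EReal) ≤ ν a) (n : ℕ) : ((n * r : ℝ) : EReal) ≤ ν (a ^ n) := by
  induction n with
  | zero => simp [h1]
  | succ n ih =>
    rw [pow_succ, hval]
    refine le_trans (le_of_eq ?_) (add_le_add ih h)
    rw [← EReal.coe_add]
    congr 1
    push_cast
    ring

theorem map_pow_eq_natCast_mul (h1 : ν 1 = 0) (hval : ∀ a b : A, ν (a * b) = ν a + ν b)
    {a : A} {r : ℝ} (h : ν a = (r : EReal)) (n : ℕ) : ν (a ^ n) = ((n * r : ℝ) : EReal) := by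
  induction n with
  | zero => simp [h1]
  | succ n ih =>
    rw [pow_succ, hval, ih, h, ← EReal.coe_add]
    congr 1
    push_cast
    ring

theorem sum_le_map_prod (h1 : ν 1 = 0) (hval : ∀ a b : A, ν (a * b) = ν a + ν b)
    {ι : Type*} (s : Finset ι) (f : ι → A) (r : ι → ℝ)
    (h : ∀ i ∈ s, (r i : EReal) ≤ ν (f i)) :
    ((∑ i ∈ s, r i : ℝ) : EReal) ≤ ν (∏ i ∈ s, f i) := by
  induction s using Finset.cons_induction with
  | empty => simp [h1]
  | cons a s ha ih =>
    rw [Finset.sum_cons, Finset.prod_cons, hval, EReal.coe_add]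
    exact add_le_add (h a (Finset.mem_cons_self a s))
      (ih fun i hi => h i (Finset.mem_cons_of_mem hi))

end Multiplicative

namespace EReal

theorem coe_le_coe_add_coe_mul_iff {b k c : ℝ} (hc : 0 < c) {v : EReal} :
    (b : EReal) ≤ (k : EReal) + (c : EReal) * v ↔ (((b - k) / c : ℝ) : EReal) ≤ v := by
  induction v with
  | bot => simp [coe_mul_bot_of_pos hc]
  | coe v =>
    rw [← coe_mul, ← coe_add, EReal.coe_le_coe_iff, EReal.coe_le_coe_iff, div_le_iff₀ hc,
      sub_le_iff_le_add',
      mul_comm c]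
  | top => simp [coe_mul_top_of_pos hc]

theorem coe_add_coe_mul_le_coe_iff {b k c : ℝ} (hc : 0 < c) {v : EReal} :
    (k : EReal) + (c : EReal) * v ≤ (b : EReal) ↔ v ≤ (((b - k) / c : ℝ) : EReal) := by
  induction v with
  | bot => simp [coe_mul_bot_of_pos hc]
  | coe v =>
    rw [← coe_mul, ← coe_add, EReal.coe_le_coe_iff, EReal.coe_le_coe_iff, le_div_iff₀ hc,
      le_sub_iff_add_le',
      mul_comm c]
  | top => simp [coe_mul_top_of_pos hc]

end EReal

/-- The first `n + 1` components of `x` satisfy `p ^ (-k) * ν (x_k) + l * k ≥ M`. -/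
def HasGaussBound {p : ℕ} {A : Type*} (ν : A → EReal) (l M : ℝ) (n : ℕ)
    (x : WittVector p A) : Prop :=
  ∀ k ≤ n, (((p : ℝ) ^ k * (M - l * k) : ℝ) : EReal) ≤ ν (x.coeff k)

namespace HasGaussBound

open WittVector

section

variable {p : ℕ} {A : Type*} {ν : A → EReal} {l M M' : ℝ} {n : ℕ} {x : WittVector p A}

theorem mono (h : HasGaussBound ν l M n x) (hM : M' ≤ M) : HasGaussBound ν l M' n x := by
  intro k hk
  refine le_trans (EReal.coe_le_coe_iff.mpr ?_) (h k hk)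
  gcongr

theorem mono_weight {l' : ℝ} (h : HasGaussBound ν l M n x) (hl : l ≤ l') :
    HasGaussBound ν l' M n x := by
  intro k hk
  refine le_trans (EReal.coe_le_coe_iff.mpr ?_) (h k hk)
  gcongr

/-- A Gauss bound for some weight is attained, for every larger weight, at a first component. -/
theorem exists_first_attained [Fact p.Prime] {l' T : ℝ} (hl : l < l')
    (hx : ∀ n, HasGaussBound ν l M n x) {a : ℕ}
    (ha : ν (x.coeff a) < (((p : ℝ) ^ a * (T - l' * a) : ℝ) : EReal)) :
    ∃ i, ∃ B < T, (∀ n, HasGaussBound ν l' B n x) ∧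
      ν (x.coeff i) = ((p : ℝ) ^ i * (B - l' * i) : ℝ) ∧
      ∀ k < i, (((p : ℝ) ^ k * (B - l' * k) : ℝ) : EReal) < ν (x.coeff k) := by
  have hp : ∀ k : ℕ, (0 : ℝ) < ((p : ℝ) ^ k)⁻¹ := fun k => by
    have : 0 < p := (Fact.out : p.Prime).pos
    positivity
  have hdiv : ∀ (b : ℝ) (k : ℕ), (b - l' * k) / ((p : ℝ) ^ k)⁻¹ = (p : ℝ) ^ k * (b - l' * k) :=
    fun b k => by rw [div_inv_eq_mul, mul_comm]
  let d : ℕ → EReal := fun k => ((l' * k : ℝ) : EReal) + ((((p : ℝ) ^ k)⁻¹ : ℝ) : EReal) *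
    ν (x.coeff k)
  have hle : ∀ (b : ℝ) (k : ℕ), (b : EReal) ≤ d k ↔
      (((p : ℝ) ^ k * (b - l' * k) : ℝ) : EReal) ≤ ν (x.coeff k) := fun b k => by
    rw [EReal.coe_le_coe_add_coe_mul_iff (hp k), hdiv]
  have hge : ∀ (b : ℝ) (k : ℕ), d k ≤ (b : EReal) ↔
      ν (x.coeff k) ≤ (((p : ℝ) ^ k * (b - l' * k) : ℝ) : EReal) := fun b k => by
    rw [EReal.coe_add_coe_mul_le_coe_iff (hp k), hdiv]
  have hda : d a < T := lt_of_not_ge fun h => ha.not_ge ((hle _ _).mp h)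
  obtain ⟨N, hN⟩ := exists_nat_gt ((T - M) / (l' - l))
  have hlarge : ∀ k ≥ N, (T : EReal) ≤ d k := by
    intro k hk
    rw [hle]
    refine le_trans (EReal.coe_le_coe_iff.mpr ?_) (hx k k le_rfl)
    have hk' : (T - M) / (l' - l) < k := hN.trans_le (by exact_mod_cast hk)
    rw [div_lt_iff₀ (sub_pos.mpr hl)] at hk'
    gcongr ?_ * ?_
    linarith
  obtain ⟨i₀, -, hi₀⟩ := Finset.exists_min_image (Finset.range N) d
    ⟨a, Finset.mem_range.mpr (lt_of_not_ge fun h => hda.not_ge (hlarge a h))⟩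
  have hex : ∃ i, ∀ k, d i ≤ d k := by
    refine ⟨i₀, fun k => ?_⟩
    have ha' := hi₀ a (Finset.mem_range.mpr (lt_of_not_ge fun h => hda.not_ge (hlarge a h)))
    by_cases hk : k < N
    · exact hi₀ k (Finset.mem_range.mpr hk)
    · exact ha'.trans (hda.le.trans (hlarge k (not_lt.mp hk)))
  have hmin := Nat.find_spec hex
  have hfirst : ∀ k < Nat.find hex, d (Nat.find hex) < d k := fun k hk =>
    lt_of_not_ge fun h => Nat.find_min hex hk fun m => h.trans (hmin m)
  generalize Nat.find hex = i at hmin hfirst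
  have hlt : d i < T := (hmin a).trans_lt hda
  have hbot : d i ≠ ⊥ := by
    refine ne_bot_of_le_ne_bot (EReal.coe_ne_bot M) ((hle M i).mpr ?_)
    exact (hx i).mono_weight hl.le i le_rfl
  obtain ⟨B, hB⟩ : ∃ B : ℝ, (B : EReal) = d i :=
    ⟨(d i).toReal, EReal.coe_toReal (ne_top_of_lt hlt) hbot⟩
  refine ⟨i, B, ?_, fun n k _ => ?_, le_antisymm ?_ ?_, fun k hk => ?_⟩
  · rwa [← hB, EReal.coe_lt_coe_iff] at hlt
  · exact (hle B k).mp (hB.trans_le (hmin k))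
  · exact (hge B i).mp hB.ge
  · exact (hle B i).mp hB.le
  · exact lt_of_not_ge fun h => ((hge B k).mpr h).not_gt (hB ▸ hfirst k hk)

variable [CommRing A]

theorem of_coeff_eq_zero (hν : IsPseudovaluation ν) (h : ∀ k ≤ n, x.coeff k = 0) :
    HasGaussBound ν l M n x := by
  intro k hk
  simp [h k hk, hν.map_zero]

/-- A Gauss bound whose initial inequalities are strict can be improved on an initial part. -/
theorem eventually_init (hν : IsPseudovaluation ν) {i : ℕ}
    (h : ∀ k < i, (((p : ℝ) ^ k * (M - l * k) : ℝ) : EReal) < ν (x.coeff k)) :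
    ∀ᶠ δ in nhds (0 : ℝ), ∀ n, HasGaussBound ν l (M + δ) n (init i x) := by
  have hev : ∀ k ∈ Finset.range i, ∀ᶠ δ in nhds (0 : ℝ),
      (((p : ℝ) ^ k * (M + δ - l * k) : ℝ) : EReal) < ν (x.coeff k) := by
    intro k hk
    have hc : Continuous fun δ : ℝ => (((p : ℝ) ^ k * (M + δ - l * k) : ℝ) : EReal) :=
      continuous_coe_real_ereal.comp (by fun_prop)
    refine hc.continuousAt.eventually_lt continuousAt_const ?_
    simpa using h k (Finset.mem_range.mp hk)
  filter_upwards [(Filter.eventually_all_finset _).mpr hev] with δ hδ n k _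
  by_cases hk : k < i
  · simpa [init, select, hk] using (hδ k (Finset.mem_range.mpr hk)).le
  · simp [init, select, hk, hν.map_zero]

end

variable {p : ℕ} [hp : Fact p.Prime] {A : Type*} [CommRing A] {ν : A → EReal} {l M M' : ℝ} {n : ℕ}
  {x y : WittVector p A}

theorem sub (hν : IsPseudovaluation ν) (hval : ∀ a b : A, ν (a * b) = ν a + ν b) (hl : 0 ≤ l)
    (hx : HasGaussBound ν l M n x) (hy : HasGaussBound ν l M n y) :
    HasGaussBound ν l M n (x - y) := by
  intro k hk
  rw [WittVector.sub_coeff, WittVector.peval, MvPolynomial.aeval_def, MvPolynomial.eval₂_eq,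
    ← hν.mem_lowerBoundAddSubgroup]
  refine sum_mem fun d hd => ?_
  have hw := isWeightedHomogeneous_wittSub (p := p) k (MvPolynomial.mem_support_iff.mp hd)
  rw [Finsupp.weight_apply, Finsupp.sum] at hw
  rw [eq_intCast, ← zsmul_eq_mul]
  refine zsmul_mem ?_ _
  rw [hν.mem_lowerBoundAddSubgroup]
  have hlt : ∀ b ∈ d.support, b.2 ≤ k := by
    intro b hb
    refine (Nat.pow_le_pow_iff_right hp.out.one_lt).mp ?_
    rw [← hw]
    refine le_trans ?_ (Finset.single_le_sum (f := fun b => d b • p ^ b.2)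
      (fun _ _ => Nat.zero_le _) hb)
    exact Nat.le_mul_of_pos_left _ (Nat.pos_of_ne_zero (Finsupp.mem_support_iff.mp hb))
  have hb : ∀ b ∈ d.support, (((d b : ℕ) * ((p : ℝ) ^ b.2 * (M - l * b.2)) : ℝ) : EReal) ≤
      ν (Function.uncurry ![x.coeff, y.coeff] b ^ d b) := by
    rintro ⟨b, i⟩ hb
    refine natCast_mul_le_map_pow hν.map_one hval ?_ _
    fin_cases b
    · exact hx i ((hlt _ hb).trans hk)
    · exact hy i ((hlt _ hb).trans hk)
  refine le_trans (EReal.coe_le_coe_iff.mpr ?_)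
    (sum_le_map_prod hν.map_one hval d.support _ _ hb)
  have hw' : (p : ℝ) ^ k = ∑ b ∈ d.support, (d b : ℝ) * (p : ℝ) ^ b.2 := by
    rw [← Nat.cast_pow, ← hw]
    push_cast [smul_eq_mul]
    rfl
  rw [hw', Finset.sum_mul]
  refine Finset.sum_le_sum fun b hb => ?_
  rw [mul_assoc]
  have : (b.2 : ℝ) ≤ k := by exact_mod_cast hlt b hb
  gcongr

theorem zero (hν : IsPseudovaluation ν) : HasGaussBound ν l M n (0 : WittVector p A) := by
  intro k _
  simp [hν.map_zero]

theorem add (hν : IsPseudovaluation ν) (hval : ∀ a b : A, ν (a * b) = ν a + ν b) (hl : 0 ≤ l)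
    (hx : HasGaussBound ν l M n x) (hy : HasGaussBound ν l M n y) :
    HasGaussBound ν l M n (x + y) := by
  simpa using hx.sub hν hval hl ((zero hν).sub hν hval hl hy)

/-- To prove an additive property of all Witt vectors satisfying a Gauss bound, it is enough to
treat shifted Teichmüller representatives and Witt vectors whose first components vanish. -/
theorem induction_on {P : WittVector p A → Prop} (hν : IsPseudovaluation ν)
    (hadd : ∀ x y, P x → P y → P (x + y))
    (hteich : ∀ k a, k ≤ n → (((p : ℝ) ^ k * (M - l * k) : ℝ) : EReal) ≤ ν a →
      P (verschiebung^[k] (teichmuller p a)))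
    (hzero : ∀ x, P (verschiebung^[n + 1] x))
    (hx : HasGaussBound ν l M n x) : P x := by
  suffices h : ∀ j k (x : WittVector p A), k + j = n + 1 →
      HasGaussBound ν l M n (verschiebung^[k] x) → P (verschiebung^[k] x) from
    h (n + 1) 0 x (zero_add _) hx
  intro j
  induction j with
  | zero =>
    rintro k x rfl -
    exact hzero x
  | succ j ih =>
    intro k x hk hx
    have hx0 : x = teichmuller p (x.coeff 0) + verschiebung (x.shift 1) := by
      ext m
      rw [coeff_add_of_disjoint]
      · cases m with
        | zero => simp
        | succ m => simp [teichmuller_coeff_pos, shift_coeff, add_comm]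
      · intro m
        cases m with
        | zero => simp
        | succ m => simp [teichmuller_coeff_pos]
    have hsum : verschiebung^[k] x =
        verschiebung^[k] (teichmuller p (x.coeff 0)) + verschiebung^[k + 1] (x.shift 1) := by
      rw [Function.iterate_succ_apply]
      conv_lhs => rw [hx0]
      exact iterate_map_add _ _ _ _
    rw [hsum]
    refine hadd _ _ (hteich _ _ (by omega) ?_) (ih _ _ (by omega) fun m hm => ?_)
    · have := hx k (by omega)
      have hc := iterate_verschiebung_coeff x k 0
      rw [zero_add] at hc
      rwa [hc] at this
    · obtain h | h := lt_or_ge m (k + 1)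
      · rw [iterate_verschiebung_coeff_eq_zero _ h, hν.map_zero]
        exact le_top
      · obtain ⟨i, rfl⟩ := Nat.exists_eq_add_of_le' h
        have := hx _ hm
        rw [iterate_verschiebung_coeff]
        rwa [show i + (k + 1) = (i + 1) + k by omega, iterate_verschiebung_coeff,
          add_comm i 1, ← shift_coeff, show (1 + i) + k = i + (k + 1) by omega] at this

theorem iterate_verschiebung_of_lt (hν : IsPseudovaluation ν) (x : WittVector p A) {m : ℕ}
    (h : n < m) : HasGaussBound ν l M n (verschiebung^[m] x) :=
  of_coeff_eq_zero hν fun _ hk => iterate_verschiebung_coeff_eq_zero _ (hk.trans_lt h)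

theorem mul [CharP A p] (hν : IsPseudovaluation ν) (hval : ∀ a b : A, ν (a * b) = ν a + ν b)
    (hl : 0 ≤ l) (hx : HasGaussBound ν l M n x) (hy : HasGaussBound ν l M' n y) :
    HasGaussBound ν l (M + M') n (x * y) := by
  refine induction_on (P := fun x => HasGaussBound ν l (M + M') n (x * y)) hν ?_ ?_ ?_ hx
  · intro x₁ x₂ h₁ h₂
    rw [add_mul]
    exact h₁.add hν hval hl h₂
  · intro k a _ ha
    refine induction_on (P := fun y => HasGaussBound ν l (M + M') n
      (verschiebung^[k] (teichmuller p a) * y)) hν ?_ ?_ ?_ hy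
    · intro y₁ y₂ h₁ h₂
      rw [mul_add]
      exact h₁.add hν hval hl h₂
    · intro j b _ hb
      have hfrob : ∀ (i : ℕ) (c : A),
          frobenius^[i] (teichmuller p c) = teichmuller p (c ^ p ^ i) := by
        intro i c
        ext m
        rw [iterate_frobenius_coeff]
        cases m with
        | zero => rw [teichmuller_coeff_zero, teichmuller_coeff_zero]
        | succ m =>
          rw [teichmuller_coeff_pos _ _ _ m.succ_pos, teichmuller_coeff_pos _ _ _ m.succ_pos,
            zero_pow (pow_ne_zero i hp.out.ne_zero)]
      rw [iterate_verschiebung_mul, hfrob, hfrob, ← map_mul]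
      intro m _
      obtain h | h := lt_or_ge m (k + j)
      · simp [iterate_verschiebung_coeff_eq_zero _ h, hν.map_zero]
      · obtain ⟨i, rfl⟩ := Nat.exists_eq_add_of_le' h
        rw [iterate_verschiebung_coeff]
        cases i with
        | zero =>
          rw [teichmuller_coeff_zero, hval, zero_add]
          refine le_trans (le_of_eq ?_) (add_le_add
            (natCast_mul_le_map_pow hν.map_one hval ha _)
            (natCast_mul_le_map_pow hν.map_one hval hb _))
          rw [← EReal.coe_add]
          congr 1
          push_cast
          ring
        | succ i =>
          rw [teichmuller_coeff_pos _ _ _ i.succ_pos, hν.map_zero]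
          exact le_top
    · intro y
      rw [iterate_verschiebung_mul]
      exact iterate_verschiebung_of_lt hν _ (by omega)
  · intro x
    rw [iterate_verschiebung_mul_left]
    exact iterate_verschiebung_of_lt hν _ (by omega)

/-- If the bounds `M` for `x` and `M'` for `y` are first attained at `i` and `j`, then the bound
`M + M'` for `x * y` is attained at or before `i + j`. -/
theorem not_mul [CharP A p] (hν : IsPseudovaluation ν)
    (hval : ∀ a b : A, ν (a * b) = ν a + ν b) (hl : 0 ≤ l) {i j : ℕ}
    (hx : ∀ n, HasGaussBound ν l M n x) (hy : ∀ n, HasGaussBound ν l M' n y)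
    (hxi : ν (x.coeff i) = ((p : ℝ) ^ i * (M - l * i) : ℝ))
    (hyj : ν (y.coeff j) = ((p : ℝ) ^ j * (M' - l * j) : ℝ))
    (hxlt : ∀ k < i, (((p : ℝ) ^ k * (M - l * k) : ℝ) : EReal) < ν (x.coeff k))
    (hylt : ∀ k < j, (((p : ℝ) ^ k * (M' - l * k) : ℝ) : EReal) < ν (y.coeff k))
    {N : ℝ} (hN : M + M' < N) : ¬ HasGaussBound ν l N (i + j) (x * y) := by
  intro hxy
  have hsmall : ∀ᶠ δ in nhds (0 : ℝ), M + M' + δ < N := by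
    have hc : Continuous fun δ : ℝ => M + M' + δ := by fun_prop
    exact hc.continuousAt.eventually_lt continuousAt_const (by simpa using hN)
  obtain ⟨δ, ⟨hδN, hδx, hδy⟩, hδ⟩ := (((hsmall.and ((eventually_init hν hxlt).and
    (eventually_init hν hylt))).filter_mono nhdsWithin_le_nhds).and
      (self_mem_nhdsWithin (s := Set.Ioi (0 : ℝ)))).exists
  replace hδ : 0 < δ := hδ
  have htail : ∀ (z : WittVector p A) (m : ℕ),
      tail m z = verschiebung^[m] ((tail m z).shift m) := fun z m =>
    eq_iterate_verschiebung fun k hk => by simp [tail, select, hk]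
  have htail0 : ∀ (z : WittVector p A) (m : ℕ), ((tail m z).shift m).coeff 0 = z.coeff m := by
    intro z m
    simp [shift_coeff, tail, select]
  have htailB : ∀ {z : WittVector p A} {B : ℝ} (m n : ℕ), HasGaussBound ν l B n z →
      HasGaussBound ν l B n (tail m z) := by
    intro z B m n hz k hk
    by_cases h : m ≤ k
    · simpa [tail, select, h] using hz k hk
    · simp [tail, select, h, hν.map_zero]
  have hprod : tail i x * tail j y = x * y - (init i x * y + tail i x * init j y) := by
    linear_combination y * init_add_tail x i + tail i x * init_add_tail y j
  have h1 : HasGaussBound ν l (M + M' + δ) (i + j) (init i x * y) :=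
    ((hδx _).mul hν hval hl (hy _)).mono (by linarith)
  have h2 : HasGaussBound ν l (M + M' + δ) (i + j) (tail i x * init j y) :=
    ((htailB i _ (hx _)).mul hν hval hl (hδy _)).mono (by linarith)
  have h3 := (hxy.mono hδN.le).sub hν hval hl (h1.add hν hval hl h2)
  rw [← hprod, htail x, htail y] at h3
  have h4 := h3 (i + j) le_rfl
  rw [iterate_verschiebung_mul_coeff, htail0, htail0, hval,
    map_pow_eq_natCast_mul hν.map_one hval hxi, map_pow_eq_natCast_mul hν.map_one hval hyj,
    ← EReal.coe_add, EReal.coe_le_coe_iff] at h4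
  have hpos : 0 < (p : ℝ) ^ (i + j) := by
    have := hp.out.pos
    positivity
  have h5 : (p : ℝ) ^ (i + j) * (M + M' + δ - l * (i + j)) ≤
      (p : ℝ) ^ (i + j) * (M + M' - l * (i + j)) := by
    push_cast at h4
    refine h4.trans (le_of_eq ?_)
    ring
  have := le_of_mul_le_mul_left h5 hpos
  linarith

end HasGaussBound

theorem coe_le_gaussNorm_iff {p : ℕ} [Fact p.Prime] {A : Type*} [CommRing A] {ν : A → EReal}
    {ε : ℝ} (hε : 0 < ε) {x : WittVector p A} {M : ℝ} :
    (M : EReal) ≤ gaussNorm p ν ε x ↔ ∀ n, HasGaussBound ν ε⁻¹ (M / ε) n x := by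
  have hp : (0 : ℝ) < p := by exact_mod_cast (Fact.out : p.Prime).pos
  have hterm : ∀ k : ℕ, (M : EReal) ≤ (k : EReal) +
      ((ε * (p : ℝ) ^ (-(k : ℤ)) : ℝ) : EReal) * ν (x.coeff k) ↔
      (((p : ℝ) ^ k * (M / ε - ε⁻¹ * k) : ℝ) : EReal) ≤ ν (x.coeff k) := by
    intro k
    rw [← EReal.coe_natCast, EReal.coe_le_coe_add_coe_mul_iff (by positivity)]
    have : (M - k) / (ε * (p : ℝ) ^ (-(k : ℤ))) = (p : ℝ) ^ k * (M / ε - ε⁻¹ * k) := by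
      rw [zpow_neg, zpow_natCast]
      field_simp
    rw [this]
  rw [gaussNorm, le_iInf_iff]
  exact ⟨fun h n k _ => (hterm k).mp (h k), fun h k => (hterm k).mpr (h k k le_rfl)⟩

theorem exists_coeff_lt_of_gaussNorm_lt {p : ℕ} [Fact p.Prime] {A : Type*} [CommRing A]
    {ν : A → EReal} {ε : ℝ} (hε : 0 < ε) {x : WittVector p A} {T : ℝ}
    (h : gaussNorm p ν ε x < T) :
    ∃ a, ν (x.coeff a) < (((p : ℝ) ^ a * (T / ε - ε⁻¹ * a) : ℝ) : EReal) := by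
  by_contra! hc
  exact h.not_ge ((coe_le_gaussNorm_iff hε).mpr fun n k _ => hc k)

theorem eventually_lt_coe_weight {p a : ℕ} {T l : ℝ} {v : EReal}
    (h : v < (((p : ℝ) ^ a * (T - l * a) : ℝ) : EReal)) :
    ∀ᶠ l' in nhds l, v < (((p : ℝ) ^ a * (T - l' * a) : ℝ) : EReal) := by
  have hc : Continuous fun l' : ℝ => (((p : ℝ) ^ a * (T - l' * a) : ℝ) : EReal) :=
    continuous_coe_real_ereal.comp (by fun_prop)
  exact continuousAt_const.eventually_lt hc.continuousAt h

/-- If `ν` is moreover a valuation, the Gauss norm is multiplicative on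
Witt vectors of radius of convergence `ε`. -/
theorem statement1 (p : ℕ) [Fact p.Prime] (A : Type*) [CommRing A]
    (hpA : ((p : ℕ) : A) = 0)
    (ν : A → EReal) (hν : IsPseudovaluation ν) (hproper : ∀ a : A, ν a ≠ ⊥)
    (hval : ∀ a b : A, ν (a * b) = ν a + ν b)
    (ε : ℝ) (hε : 0 < ε) :
    ∀ ξ η : WittVector p A, gaussNorm p ν ε ξ ≠ ⊥ → gaussNorm p ν ε η ≠ ⊥ →
      gaussNorm p ν ε (ξ * η) = gaussNorm p ν ε ξ + gaussNorm p ν ε η := by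
  intro ξ η hξ hη
  have hchar : CharP A p := by
    have : Nontrivial A := ⟨⟨1, 0, fun h => by
      have h0 := hν.map_zero
      rw [← h, hν.map_one] at h0
      exact EReal.zero_ne_top h0⟩⟩
    exact (CharP.charP_iff_prime_eq_zero Fact.out).mpr hpA
  have hl : 0 ≤ ε⁻¹ := (inv_pos.mpr hε).le
  refine le_antisymm ?_ ?_
  · refine EReal.le_add_of_forall_gt (Or.inl hξ) (Or.inr hη) fun a ha b hb => ?_
    obtain ⟨T, hT, hTa⟩ := EReal.lt_iff_exists_real_btwn.mp ha
    obtain ⟨T', hT', hTb⟩ := EReal.lt_iff_exists_real_btwn.mp hb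
    refine le_trans ?_ (add_le_add hTa.le hTb.le)
    by_contra! hlt
    obtain ⟨N, hN, hNlt⟩ := EReal.lt_iff_exists_real_btwn.mp hlt
    rw [← EReal.coe_add, EReal.coe_lt_coe_iff] at hN
    obtain ⟨m, -, hm⟩ := EReal.lt_iff_exists_real_btwn.mp (bot_lt_iff_ne_bot.mpr hξ)
    obtain ⟨m', -, hm'⟩ := EReal.lt_iff_exists_real_btwn.mp (bot_lt_iff_ne_bot.mpr hη)
    obtain ⟨s, hs⟩ := exists_coeff_lt_of_gaussNorm_lt hε hT
    obtain ⟨t, ht⟩ := exists_coeff_lt_of_gaussNorm_lt hε hT'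
    obtain ⟨l, ⟨hsl, htl⟩, hl'⟩ := ((((eventually_lt_coe_weight hs).and
      (eventually_lt_coe_weight ht)).filter_mono nhdsWithin_le_nhds).and
        (self_mem_nhdsWithin (s := Set.Ioi ε⁻¹))).exists
    replace hl' : ε⁻¹ < l := hl'
    obtain ⟨i, B, hB, hξB, hξi, hξlt⟩ := HasGaussBound.exists_first_attained hl'
      ((coe_le_gaussNorm_iff hε).mp hm.le) hsl
    obtain ⟨j, B', hB', hηB, hηj, hηlt⟩ := HasGaussBound.exists_first_attained hl'
      ((coe_le_gaussNorm_iff hε).mp hm'.le) htl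
    have hBN : B + B' < N / ε := by
      refine (add_lt_add hB hB').trans ?_
      rw [← add_div]
      gcongr
    exact HasGaussBound.not_mul hν hval (hl.trans hl'.le) hξB hηB hξi hηj hξlt hηlt hBN
      (((coe_le_gaussNorm_iff hε).mp hNlt.le _).mono_weight hl'.le)
  · refine EReal.add_le_of_forall_lt fun a ha b hb => ?_
    obtain ⟨m, hma, hm⟩ := EReal.lt_iff_exists_real_btwn.mp ha
    obtain ⟨m', hmb, hm'⟩ := EReal.lt_iff_exists_real_btwn.mp hb
    refine (add_le_add hma.le hmb.le).trans ?_
    rw [← EReal.coe_add, coe_le_gaussNorm_iff hε, add_div]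
    exact fun n => ((coe_le_gaussNorm_iff hε).mp hm.le n).mul hν hval hl
      ((coe_le_gaussNorm_iff hε).mp hm'.le n)
end
end

section
/- Let K be a field of characteristic p > 0, let A be a smooth finitely generated K-algebra, and let φ : A → B be an injective homomorphism of finitely generated K-algebras making B a smooth A-algebra. Equip A and B with admissible pseudovaluations (over K with the trivial valuation). Then W(A) ∩ W†(B) = W†(A): a Witt vector x ∈ W(A) is overconvergent if and only if its image W(φ)(x) ∈ W(B) is overconvergent. -/
open scoped Classical

noncomputable section

universe u

theorem isReduced_of_etale_of_isDomain (S A : Type u) [CommRing S] [IsDomain S] [CommRing A]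
    [Algebra S A] [Algebra.Etale S A] : IsReduced A := by
  have hinj : Function.Injective
      (Algebra.TensorProduct.includeRight : A →ₐ[S] TensorProduct S (FractionRing S) A) :=
    Algebra.TensorProduct.includeRight_injective (IsFractionRing.injective S (FractionRing S))
  have : IsReduced (TensorProduct S (FractionRing S) A) :=
    Algebra.FormallyUnramified.isReduced_of_field (FractionRing S) _
  exact isReduced_of_injective _ hinj

theorem isReduced_of_smooth_field (K A : Type u) [Field K] [CommRing A] [Algebra K A]
    [Algebra.Smooth K A] : IsReduced A := by
  constructor
  intro x hx
  by_contra hx0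
  have hne : Ideal.span {x} ≠ ⊥ := by simpa using hx0
  obtain ⟨m, hm, hle⟩ := Ideal.exists_le_maximal (Module.annihilator A (Ideal.span {x})) (by
    intro h
    rw [Module.annihilator_eq_top_iff] at h
    exact hne (Submodule.subsingleton_iff_eq_bot.mp h))
  obtain ⟨f, hfm, n, _, _, _⟩ :=
    Algebra.IsSmoothAt.exists_isStandardEtale_mvPolynomial (R := K) (p := m)
  have : IsReduced (Localization.Away f) :=
    isReduced_of_etale_of_isDomain (MvPolynomial (Fin n) K) _
  have h0 : algebraMap A (Localization.Away f) x = 0 := (hx.map _).eq_zero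
  rw [IsLocalization.map_eq_zero_iff (Submonoid.powers f)] at h0
  obtain ⟨⟨_, k, rfl⟩, hk⟩ := h0
  refine hfm (hm.isPrime.mem_of_pow_mem k (hle ?_))
  rw [Module.mem_annihilator]
  rintro ⟨y, hy⟩
  obtain ⟨z, rfl⟩ := Ideal.mem_span_singleton.mp hy
  ext
  simp only [SetLike.mk_smul_mk, smul_eq_mul, ZeroMemClass.coe_zero]
  rw [← mul_assoc]; simp_all

namespace MvPolynomial

theorem totalDegree_aeval_le {K σ τ : Type*} [CommRing K] (g : σ → MvPolynomial τ K) (C : ℕ)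
    (hg : ∀ i, (g i).totalDegree ≤ C) (f : MvPolynomial σ K) :
    (aeval g f).totalDegree ≤ C * f.totalDegree := by
  rw [aeval_def, eval₂_eq]
  refine totalDegree_finsetSum_le fun d hd => ?_
  refine (totalDegree_mul _ _).trans ?_
  rw [algebraMap_eq, totalDegree_C, zero_add]
  refine (totalDegree_finsetProd _ _).trans ?_
  calc ∑ i ∈ d.support, (g i ^ d i).totalDegree ≤ ∑ i ∈ d.support, C * d i := by
        refine Finset.sum_le_sum fun i _ => (totalDegree_pow _ _).trans ?_
        rw [mul_comm]; exact Nat.mul_le_mul_right _ (hg i)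
    _ = C * (d.sum fun _ e => e) := by rw [Finsupp.sum, Finset.mul_sum]
    _ ≤ _ := Nat.mul_le_mul_left _ (le_totalDegree hd)

theorem exists_finset_forall_mem_ideal {K σ : Type*} [Field K] [Finite σ]
    (I : Ideal (MvPolynomial σ K)) :
    ∃ T : Finset (MvPolynomial σ K), (∀ b ∈ T, b ∈ I) ∧ ∀ v ∈ I,
      ∃ q : T → MvPolynomial σ K, v = ∑ b : T, q b * b ∧
        ∀ b, (q b).totalDegree ≤ v.totalDegree := by
  let _ : LinearOrder σ := IsWellOrder.linearOrder WellOrderingRel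
  let m : MonomialOrder σ := MonomialOrder.degLex
  let E : Set (σ →₀ ℕ) := {e | ∃ f ∈ I, f ≠ 0 ∧ m.degree f = e}
  have hE : E.IsPWO := Set.isPWO_of_wellQuasiOrderedLE E
  have hfin : {e | Minimal (· ∈ E) e}.Finite :=
    (setOfPred_minimal_antichain (· ∈ E)).finite_of_partiallyWellOrderedOn
      (hE.mono fun e he => he.prop)
  have hch : ∀ e : {e | Minimal (· ∈ E) e}, ∃ f ∈ I, f ≠ 0 ∧ m.degree f = e :=
    fun e => e.2.prop
  choose F hFI hF0 hFd using hch
  have := hfin.fintype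
  refine ⟨Finset.univ.image F, fun b hb => ?_, fun v hv => ?_⟩
  · obtain ⟨e, -, rfl⟩ := Finset.mem_image.mp hb
    exact hFI e
  set T := Finset.univ.image F
  have hTI : ∀ b : T, (b : MvPolynomial σ K) ∈ I ∧ (b : MvPolynomial σ K) ≠ 0 := by
    rintro ⟨b, hb⟩
    obtain ⟨e, -, rfl⟩ := Finset.mem_image.mp hb
    exact ⟨hFI e, hF0 e⟩
  obtain ⟨g, r, hgr, hdeg, hr⟩ := m.div (b := fun b : T => (b : MvPolynomial σ K))
    (fun b => isUnit_iff_ne_zero.mpr (m.leadingCoeff_ne_zero_iff.mpr (hTI b).2)) v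
  have hsum : Finsupp.linearCombination (MvPolynomial σ K)
      (fun b : T => (b : MvPolynomial σ K)) g = ∑ b : T, g b * b := by
    rw [Finsupp.linearCombination_apply, Finsupp.sum_fintype _ _ (by simp)]
    rfl
  have hrI : r ∈ I := by
    have : r = v - ∑ b : T, g b * b := by rw [← hsum, hgr]; ring
    rw [this]
    exact I.sub_mem hv (I.sum_mem fun b _ => I.mul_mem_left _ (hTI b).1)
  have hr0 : r = 0 := by
    by_contra hne
    obtain ⟨e, hle, he⟩ := hE.exists_le_minimal (a := m.degree r) ⟨r, hrI, hne, rfl⟩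
    refine hr _ (m.degree_mem_support hne)
      ⟨F ⟨e, he⟩, Finset.mem_image_of_mem _ (Finset.mem_univ _)⟩ ?_
    simpa [hFd] using hle
  refine ⟨g, by rw [hgr, hr0, hsum, add_zero], fun b => ?_⟩
  by_cases hb : g b = 0
  · simp [hb]
  have h1 := degLex_totalDegree_monotone (hdeg b)
  rw [totalDegree_mul_of_isDomain (hTI b).2 hb] at h1
  omega

theorem exists_bound_mem_span_range {K σ κ : Type*} [Field K] [Finite σ] [Fintype κ]
    (w : κ → MvPolynomial σ K) :
    ∃ D : ℕ, ∀ v ∈ Ideal.span (Set.range w), ∃ s : κ → MvPolynomial σ K,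
      ∑ j, s j * w j = v ∧ ∀ j, (s j).totalDegree ≤ v.totalDegree + D := by
  obtain ⟨T, hT, hdiv⟩ := exists_finset_forall_mem_ideal (Ideal.span (Set.range w))
  have hT' : ∀ b : T, ∃ c : κ → MvPolynomial σ K, ∑ j, c j * w j = b :=
    fun b => Ideal.mem_span_range_iff_exists_fun.mp (hT b b.2)
  choose c hc using hT'
  refine ⟨∑ b : T, ∑ j, (c b j).totalDegree, fun v hv => ?_⟩
  obtain ⟨q, hq, hqd⟩ := hdiv v hv
  refine ⟨fun j => ∑ b : T, q b * c b j, ?_, fun j => ?_⟩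
  · conv_rhs => rw [hq]
    simp_rw [Finset.sum_mul]
    rw [Finset.sum_comm]
    refine Finset.sum_congr rfl fun b _ => ?_
    rw [← hc b, Finset.mul_sum]
    exact Finset.sum_congr rfl fun j _ => mul_assoc _ _ _
  · refine totalDegree_finsetSum_le fun b _ => (totalDegree_mul _ _).trans
      (add_le_add (hqd b) ?_)
    exact (Finset.single_le_sum (f := fun j => (c b j).totalDegree) (fun _ _ => Nat.zero_le _)
      (Finset.mem_univ j)).trans (Finset.single_le_sum
        (f := fun b => ∑ j, (c b j).totalDegree) (fun _ _ => Nat.zero_le _) (Finset.mem_univ b))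

theorem exists_bound_linear_system {K σ κ ι : Type*} [Field K] [Finite σ] [Fintype κ]
    [Fintype ι] (w : κ → ι → MvPolynomial σ K) :
    ∃ D : ℕ, ∀ (n : ℕ) (c : κ → MvPolynomial σ K),
      (∀ i, (∑ j, c j * w j i).totalDegree ≤ n) → ∃ s : κ → MvPolynomial σ K,
        (∀ i, ∑ j, s j * w j i = ∑ j, c j * w j i) ∧ ∀ j, (s j).totalDegree ≤ n + D := by
  let inl : MvPolynomial σ K →ₐ[K] MvPolynomial (σ ⊕ ι) K := rename Sum.inl
  let W : κ → MvPolynomial (σ ⊕ ι) K := fun j => ∑ i, inl (w j i) * X (Sum.inr i)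
  let θ : MvPolynomial (σ ⊕ ι) K →ₐ[K] MvPolynomial σ K := aeval (Sum.elim X 0)
  have hθinl : ∀ f, θ (inl f) = f := by
    intro f
    simp only [θ, inl, aeval_rename, Sum.elim_comp_inl, aeval_X_left_apply]
  have hθX : ∀ i, θ (X (Sum.inr i)) = 0 := by intro i; simp [θ]
  have hθW : ∀ j, θ (W j) = 0 := by intro j; simp [W, hθX]
  have hpd : ∀ i f, pderiv (Sum.inr i) (inl f) = 0 := by
    intro i f
    refine pderiv_eq_zero_of_notMem_vars fun h => ?_
    have := vars_rename Sum.inl f h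
    simp at this
  have hpW : ∀ i (a : ι → MvPolynomial σ K),
      θ (pderiv (Sum.inr i) (∑ i, inl (a i) * X (Sum.inr i))) = a i := by
    intro i a
    simp only [map_sum, Derivation.leibniz, hpd, pderiv_X, smul_eq_mul, mul_zero, add_zero,
      map_mul, hθinl]
    rw [Finset.sum_eq_single i]
    · simp
    · intro k _ hk
      rw [Pi.single_eq_of_ne (by simpa using hk)]; simp
    · simp
  obtain ⟨D, hD⟩ := exists_bound_mem_span_range W
  refine ⟨1 + D, fun n c hc => ?_⟩
  have hv : ∑ j, inl (c j) * W j = ∑ i, inl (∑ j, c j * w j i) * X (Sum.inr i) := by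
    simp only [W, map_sum, map_mul, Finset.mul_sum, Finset.sum_mul]
    rw [Finset.sum_comm]
    simp only [mul_assoc]
  have hvd : (∑ j, inl (c j) * W j).totalDegree ≤ n + 1 := by
    rw [hv]
    refine totalDegree_finsetSum_le fun i _ => (totalDegree_mul _ _).trans (add_le_add ?_ ?_)
    · exact (totalDegree_rename_le _ _).trans (hc i)
    · rw [totalDegree_X]
  obtain ⟨s, hs, hsd⟩ := hD (∑ j, inl (c j) * W j)
    (Ideal.sum_mem _ fun j _ => Ideal.mul_mem_left _ _ (Ideal.subset_span ⟨j, rfl⟩))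
  refine ⟨fun j => θ (s j), fun i => ?_, fun j => ?_⟩
  · have h1 : θ (pderiv (Sum.inr i) (∑ j, s j * W j)) = ∑ j, θ (s j) * w j i := by
      rw [map_sum, map_sum]
      simp only [Derivation.leibniz, smul_eq_mul, map_add, map_mul, hθW, zero_mul,
        add_zero]
      exact Finset.sum_congr rfl fun j _ => congrArg _ (hpW i (w j))
    rw [← h1, hs, hv, hpW]
  · refine (totalDegree_aeval_le _ 1 ?_ _).trans ?_
    · rintro (a | a)
      · simp
      · simp
    · have := hsd j
      omega

end MvPolynomial

theorem exists_smul_eq_sum_smul_basis {S Q L ι η : Type*} [CommRing S] [IsDomain S] [Field Q]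
    [Algebra S Q] [IsFractionRing S Q] [Field L] [Algebra Q L] [Algebra S L]
    [IsScalarTower S Q L] [Fintype η] [Finite ι] (b : Module.Basis η Q L) (x : ι → L) :
    ∃ f : S, f ≠ 0 ∧ ∃ y : ι → η → S, ∀ i, f • x i = ∑ k, y i k • b k := by
  have := Fintype.ofFinite ι
  obtain ⟨f, hf⟩ := IsLocalization.exist_integer_multiples (nonZeroDivisors S)
    (Finset.univ : Finset (ι × η)) (fun t => b.repr (x t.1) t.2)
  choose y hy using fun i k => hf (i, k) (Finset.mem_univ _)
  refine ⟨f, nonZeroDivisors.coe_ne_zero f, y, fun i => ?_⟩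
  conv_lhs => rw [← b.sum_repr (x i), Finset.smul_sum]
  refine Finset.sum_congr rfl fun k _ => ?_
  rw [← smul_assoc, ← algebraMap_smul Q (y i k), hy]

namespace MvPolynomial

variable {K L : Type*} [Field K] [Field L] [Algebra K L] {s : ℕ}
  [Algebra (MvPolynomial (Fin s) K) L] [IsScalarTower K (MvPolynomial (Fin s) K) L]

theorem exists_coordinates_of_totalDegree_le {η : Type*} [Fintype η] {l : ℕ} (b : η → L)
    (ρ : MvPolynomial (Fin l) K →ₐ[K] L)
    (f : MvPolynomial (Fin s) K) (u : η → MvPolynomial (Fin s) K)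
    (hu : f • (1 : L) = ∑ k, u k • b k)
    (y : Fin l × η → η → MvPolynomial (Fin s) K)
    (hy : ∀ j k, f • (ρ (X j) * b k) = ∑ i, y (j, k) i • b i)
    (D : ℕ) (hfD : f.totalDegree ≤ D) (huD : ∀ k, (u k).totalDegree ≤ D)
    (hyD : ∀ j k, (y j k).totalDegree ≤ D) (g : MvPolynomial (Fin l) K) :
    ∃ z : η → MvPolynomial (Fin s) K, f ^ (g.totalDegree + 1) • ρ g = ∑ k, z k • b k ∧
      ∀ k, (z k).totalDegree ≤ D * (g.totalDegree + 1) := by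
  let V : ℕ → L → Prop := fun n x => ∃ z : η → MvPolynomial (Fin s) K,
    f ^ n • x = ∑ k, z k • b k ∧ ∀ k, (z k).totalDegree ≤ D * n
  have hadd : ∀ n x x', V n x → V n x' → V n (x + x') := by
    rintro n x x' ⟨z, hz, hzd⟩ ⟨z', hz', hzd'⟩
    refine ⟨z + z', ?_, fun k => (totalDegree_add _ _).trans (max_le (hzd k) (hzd' k))⟩
    simp only [smul_add, hz, hz', Pi.add_apply, add_smul, Finset.sum_add_distrib]
  have hzero : ∀ n, V n 0 := fun n => ⟨0, by simp, by simp⟩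
  have hsum : ∀ n {τ : Type} (T : Finset τ) (x : τ → L), (∀ i ∈ T, V n (x i)) →
      V n (∑ i ∈ T, x i) := fun n τ T x h =>
    Finset.sum_induction x (V n) (hadd n) (hzero n) h
  have hsmul : ∀ n (c : K) x, V n x → V n (c • x) := by
    rintro n c x ⟨z, hz, hzd⟩
    refine ⟨fun k => c • z k, ?_, fun k => (totalDegree_smul_le _ _).trans (hzd k)⟩
    rw [smul_comm, hz, Finset.smul_sum]
    simp only [smul_assoc]
  have hstep : ∀ n x, V n x → V (n + 1) x := by
    rintro n x ⟨z, hz, hzd⟩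
    refine ⟨fun k => f * z k, ?_, fun k => (totalDegree_mul _ _).trans ?_⟩
    · rw [pow_succ', mul_smul, hz, Finset.smul_sum]
      simp only [mul_smul]
    · have := hzd k
      rw [mul_add]; omega
  have hmono : ∀ n n' x, n ≤ n' → V n x → V n' x := by
    intro n n' x h hx
    induction n', h using Nat.le_induction with
    | base => exact hx
    | succ n' _ ih => exact hstep _ _ ih
  have hX : ∀ n x j, V n x → V (n + 1) (ρ (X j) * x) := by
    rintro n x j ⟨z, hz, hzd⟩
    refine ⟨fun i => ∑ k, z k * y (j, k) i, ?_, fun i =>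
      totalDegree_finsetSum_le fun k _ => (totalDegree_mul _ _).trans ?_⟩
    · rw [pow_succ', mul_smul, ← mul_smul_comm, hz, Finset.mul_sum, Finset.smul_sum]
      simp only [Finset.sum_smul]
      rw [Finset.sum_comm]
      refine Finset.sum_congr rfl fun k _ => ?_
      rw [mul_smul_comm, smul_comm, hy, Finset.smul_sum]
      simp only [mul_smul]
    · have := hzd k
      have := hyD (j, k) i
      rw [mul_add]; omega
  have hmon : ∀ n (d : Fin l →₀ ℕ), d.degree = n → V (n + 1) (ρ (monomial d 1)) := by
    intro n
    induction n with
    | zero =>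
      intro d hd
      rw [Finsupp.degree_eq_zero_iff] at hd
      subst hd
      exact ⟨u, by simpa using hu, by simpa using huD⟩
    | succ n ih =>
      intro d hd
      have hd0 : d ≠ 0 := by rintro rfl; simp at hd
      obtain ⟨j, hj⟩ := Finsupp.ne_iff.mp hd0
      have hle : Finsupp.single j 1 ≤ d := by
        simpa [Finsupp.single_le_iff, Nat.one_le_iff_ne_zero] using hj
      have hdd : d = Finsupp.single j 1 + (d - Finsupp.single j 1) :=
        (add_tsub_cancel_of_le hle).symm
      have hdeg : (d - Finsupp.single j 1).degree = n := by
        have := congrArg Finsupp.degree hdd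
        rw [map_add, Finsupp.degree_single, hd] at this
        omega
      have := hX _ _ j (ih _ hdeg)
      rwa [← map_mul, X, monomial_mul, one_mul, ← hdd] at this
  rw [show ρ g = ∑ d ∈ g.support, coeff d g • ρ (monomial d 1) by
    conv_lhs => rw [g.as_sum, map_sum]
    refine Finset.sum_congr rfl fun d _ => ?_
    rw [← map_smul, smul_monomial, smul_eq_mul, mul_one]]
  refine hsum _ _ _ fun d hd => hsmul _ _ _ (hmono _ _ _ ?_ (hmon _ d rfl))
  exact Nat.succ_le_succ (le_totalDegree hd)
theorem exists_bound_lift_of_finite {K A Q L : Type*} {s m l : ℕ} [Field K] [CommRing A]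
    [Field Q] [Field L]
    [Algebra K A] [Algebra K L] [Algebra (MvPolynomial (Fin s) K) A]
    [IsScalarTower K (MvPolynomial (Fin s) K) A] [Module.Finite (MvPolynomial (Fin s) K) A]
    [Algebra (MvPolynomial (Fin s) K) Q] [IsFractionRing (MvPolynomial (Fin s) K) Q]
    [Algebra (MvPolynomial (Fin s) K) L] [IsScalarTower K (MvPolynomial (Fin s) K) L]
    [Algebra A L] [IsScalarTower (MvPolynomial (Fin s) K) A L]
    [Algebra Q L] [IsScalarTower (MvPolynomial (Fin s) K) Q L] [Module.Finite Q L]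
    (hinj : Function.Injective (algebraMap A L))
    (π : MvPolynomial (Fin m) K →ₐ[K] A) (hπ : Function.Surjective π)
    (ρ : MvPolynomial (Fin l) K →ₐ[K] L) :
    ∃ C D : ℕ, ∀ a g, ρ g = algebraMap A L a →
      ∃ f, π f = a ∧ f.totalDegree ≤ C * g.totalDegree + D := by
  let b := Module.finBasis Q L
  let η := Fin (Module.finrank Q L)
  have hSL : Function.Injective (algebraMap (MvPolynomial (Fin s) K) L) := by
    rw [IsScalarTower.algebraMap_eq (MvPolynomial (Fin s) K) Q L]
    exact (algebraMap Q L).injective.comp (IsFractionRing.injective _ _)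
  have hlin : LinearIndependent (MvPolynomial (Fin s) K) b :=
    b.linearIndependent.restrict_scalars (by
      intro x y h
      simpa [Algebra.smul_def] using h)
  obtain ⟨N, F, hF⟩ := Module.Finite.exists_fin' (MvPolynomial (Fin s) K) A
  let w : Fin N → A := fun j => F (Pi.single j 1)
  have hw : ∀ c, F c = ∑ j, c j • w j := fun c => by
    conv_lhs => rw [pi_eq_sum_univ c, map_sum]
    refine Finset.sum_congr rfl fun j _ => ?_
    rw [map_smul]
    congr 2
    ext1 i
    rw [Pi.single_apply]
    exact if_congr eq_comm rfl rfl
  obtain ⟨f, hf, Y, hY⟩ := exists_smul_eq_sum_smul_basis (S := MvPolynomial (Fin s) K) b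
    (Sum.elim (fun t : Fin l × η => ρ (X t.1) * b t.2)
      (Sum.elim (fun _ : Unit => 1) fun j : Fin N => algebraMap A L (w j)))
  obtain ⟨D, hD⟩ : ∃ D, f.totalDegree ≤ D ∧ ∀ i k, (Y i k).totalDegree ≤ D := by
    refine ⟨f.totalDegree + ∑ i, ∑ k, (Y i k).totalDegree, by omega, fun i k => ?_⟩
    have h1 := Finset.single_le_sum (f := fun k => (Y i k).totalDegree) (fun _ _ => Nat.zero_le _)
      (Finset.mem_univ k)
    have h2 := Finset.single_le_sum (f := fun i => ∑ k, (Y i k).totalDegree)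
      (fun _ _ => Nat.zero_le _) (Finset.mem_univ i)
    omega
  let v : Fin N → η → MvPolynomial (Fin s) K := fun j => Y (Sum.inr (Sum.inr j))
  have hv : ∀ c : Fin N → MvPolynomial (Fin s) K,
      f • algebraMap A L (∑ j, c j • w j) = ∑ k, (∑ j, c j * v j k) • b k := by
    intro c
    simp only [Finset.sum_smul, map_sum, Finset.smul_sum]
    rw [Finset.sum_comm]
    refine Finset.sum_congr rfl fun j _ => ?_
    have := hY (Sum.inr (Sum.inr j))
    simp only [Sum.elim_inr] at this
    rw [Algebra.smul_def (c j) (w j), map_mul, ← IsScalarTower.algebraMap_apply,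
      ← Algebra.smul_def, smul_comm, this, Finset.smul_sum]
    simp only [mul_smul, v]
    rfl
  obtain ⟨E, hE⟩ := exists_bound_linear_system v
  choose t ht using fun i : Fin s => hπ (algebraMap (MvPolynomial (Fin s) K) A (X i))
  choose W hW using fun j => hπ (w j)
  have hπt : ∀ c, π (aeval t c) = algebraMap (MvPolynomial (Fin s) K) A c := by
    intro c
    have : π.comp (aeval t) = IsScalarTower.toAlgHom K (MvPolynomial (Fin s) K) A := by
      ext i
      simp [ht]
    exact DFunLike.congr_fun this c
  let T := ∑ i, (t i).totalDegree
  let U := ∑ j, (W j).totalDegree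
  refine ⟨T * D, T * (D + E) + U, fun a g hag => ?_⟩
  obtain ⟨c, rfl⟩ := hF a
  rw [hw] at hag
  obtain ⟨z, hz, hzd⟩ := exists_coordinates_of_totalDegree_le b ρ f (Y (Sum.inr (Sum.inl ())))
    (hY (Sum.inr (Sum.inl ()))) (fun t => Y (Sum.inl t)) (fun j k => hY (Sum.inl (j, k)))
    D hD.1 (fun k => hD.2 _ k) (fun j k => hD.2 _ k) g
  have hcz : ∀ k, f ^ g.totalDegree * ∑ j, c j * v j k = z k := by
    have : ∑ k, (f ^ g.totalDegree * ∑ j, c j * v j k) • b k = ∑ k, z k • b k := by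
      rw [← hz, hag, pow_succ, mul_smul, hv, Finset.smul_sum]
      simp only [mul_smul]
    exact hlin.eq_coords_of_eq this
  have hdeg : ∀ k, (∑ j, c j * v j k).totalDegree ≤ D * (g.totalDegree + 1) := by
    intro k
    by_cases h0 : ∑ j, c j * v j k = 0
    · rw [h0]; simp
    · have h1 := hzd k
      rw [← hcz, totalDegree_mul_of_isDomain (pow_ne_zero _ hf) h0] at h1
      omega
  obtain ⟨c', hc', hcd⟩ := hE _ c hdeg
  have hcc : ∑ j, c' j • w j = F c := by
    apply hinj
    have hnz : Function.Injective (fun x : L => f • x) := by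
      intro x y h
      simp only [Algebra.smul_def] at h
      exact mul_left_cancel₀ ((map_ne_zero_iff _ hSL).mpr hf) h
    apply hnz
    simp only [hw, hv, hc']
  refine ⟨∑ j, aeval t (c' j) * W j, ?_, totalDegree_finsetSum_le fun j _ => ?_⟩
  · rw [← hcc, map_sum]
    simp only [map_mul, hπt, hW, Algebra.smul_def]
  · refine (totalDegree_mul _ _).trans ?_
    have h1 := totalDegree_aeval_le t T (fun i => Finset.single_le_sum
      (f := fun i => (t i).totalDegree) (fun _ _ => Nat.zero_le _) (Finset.mem_univ i)) (c' j)
    have h2 : (W j).totalDegree ≤ U := Finset.single_le_sum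
      (f := fun i => (W i).totalDegree) (fun _ _ => Nat.zero_le _) (Finset.mem_univ j)
    calc _ ≤ T * (D * (g.totalDegree + 1) + E) + U :=
          add_le_add (h1.trans (Nat.mul_le_mul_left _ (hcd j))) h2
      _ = _ := by ring

theorem exists_bound_lift_of_isAlgebraic {K A L : Type*} {m l : ℕ} [Field K] [CommRing A]
    [IsDomain A] [Field L] [Algebra K A] [Algebra K L] [Algebra A L] [IsScalarTower K A L]
    [Algebra.EssFiniteType K L] [Algebra.IsAlgebraic A L]
    (hinj : Function.Injective (algebraMap A L))
    (π : MvPolynomial (Fin m) K →ₐ[K] A) (hπ : Function.Surjective π)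
    (ρ : MvPolynomial (Fin l) K →ₐ[K] L) :
    ∃ C D : ℕ, ∀ a g, ρ g = algebraMap A L a →
      ∃ f, π f = a ∧ f.totalDegree ≤ C * g.totalDegree + D := by
  have : Algebra.FiniteType K A := Algebra.FiniteType.of_surjective π hπ
  obtain ⟨s, j, hj, hjf⟩ := exists_finite_inj_algHom_of_fg K A
  let S := MvPolynomial (Fin s) K
  let _ : Algebra S A := j.toRingHom.toAlgebra
  have : IsScalarTower K S A := IsScalarTower.of_algebraMap_eq fun x => (j.commutes x).symm
  have : Module.Finite S A := hjf
  let _ : Algebra S L := ((algebraMap A L).comp j.toRingHom).toAlgebra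
  have : IsScalarTower S A L := IsScalarTower.of_algebraMap_eq fun x => rfl
  have : IsScalarTower K S L := IsScalarTower.of_algebraMap_eq fun x => by
    rw [IsScalarTower.algebraMap_apply S A L, ← IsScalarTower.algebraMap_apply K S A,
      ← IsScalarTower.algebraMap_apply K A L]
  have : FaithfulSMul S L := (faithfulSMul_iff_algebraMap_injective S L).mpr (hinj.comp hj)
  let Q := FractionRing S
  let _ : Algebra Q L := FractionRing.liftAlgebra S L
  have : IsScalarTower S Q L := FractionRing.isScalarTower_liftAlgebra S L
  have : Algebra.IsAlgebraic S L := Algebra.IsIntegral.trans_isAlgebraic S A L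
  have : Algebra.IsAlgebraic Q L := (IsFractionRing.comap_isAlgebraic_iff (A := S)).mp this
  have : Algebra.EssFiniteType S L := Algebra.EssFiniteType.of_comp K S L
  have : Algebra.EssFiniteType Q L := Algebra.EssFiniteType.of_comp S Q L
  have : Module.Finite Q L := Algebra.finite_of_essFiniteType_of_isAlgebraic
  exact exists_bound_lift_of_finite (s := s) (Q := Q) hinj π hπ ρ

end MvPolynomial

theorem Ideal.exists_field_of_mem_minimalPrimes {A B : Type u} [CommRing A] [CommRing B]
    [Algebra A B] [Algebra.FiniteType A B] (hinj : Function.Injective (algebraMap A B))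
    (P : Ideal A) (hP : P ∈ minimalPrimes A) [P.IsPrime] :
    ∃ (L : Type u) (_ : Field L) (_ : Algebra A L) (_ : Algebra P.ResidueField L)
      (_ : IsScalarTower A P.ResidueField L) (_ : Module.Finite P.ResidueField L),
      Nonempty (B →ₐ[A] L) := by
  obtain ⟨q, hq, hqP⟩ := Ideal.exists_comap_eq_of_mem_minimalPrimes_of_injective hinj P hP
  have : Nontrivial (TensorProduct A P.ResidueField B) :=
    (PrimeSpectrum.nontrivial_iff_mem_rangeComap (S := B) ⟨P, inferInstance⟩).mpr
      ⟨⟨q, hq⟩, PrimeSpectrum.ext hqP⟩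
  obtain ⟨M, hM⟩ := Ideal.exists_maximal (TensorProduct A P.ResidueField B)
  let _ : Field (TensorProduct A P.ResidueField B ⧸ M) := Ideal.Quotient.field M
  refine ⟨TensorProduct A P.ResidueField B ⧸ M, inferInstance, inferInstance, inferInstance,
    inferInstance, finite_of_finite_type_of_isJacobsonRing _ _,
    ⟨(Ideal.Quotient.mkₐ A M).comp Algebra.TensorProduct.includeRight⟩⟩

namespace MvPolynomial

theorem exists_bound_lift_mod_minimalPrime {K A B : Type u} {m l : ℕ} [Field K] [CommRing A]
    [CommRing B] [Algebra K A] [Algebra K B] [Algebra A B] [IsScalarTower K A B]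
    [Algebra.FiniteType K B] (hinj : Function.Injective (algebraMap A B))
    (π : MvPolynomial (Fin m) K →ₐ[K] A) (hπ : Function.Surjective π)
    (ρ : MvPolynomial (Fin l) K →ₐ[K] B) (P : Ideal A) (hP : P ∈ minimalPrimes A) :
    ∃ C D : ℕ, ∀ a g, ρ g = algebraMap A B a →
      ∃ f, π f - a ∈ P ∧ f.totalDegree ≤ C * g.totalDegree + D := by
  have : P.IsPrime := Ideal.IsMinimalPrime.isPrime hP
  have : Algebra.FiniteType K A := Algebra.FiniteType.of_surjective π hπ
  have : Algebra.FiniteType A B := Algebra.FiniteType.of_restrictScalars_finiteType K A B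
  obtain ⟨L, _, _, _, _, _, ⟨σ⟩⟩ := Ideal.exists_field_of_mem_minimalPrimes hinj P hP
  let _ : Algebra K L := ((algebraMap A L).comp (algebraMap K A)).toAlgebra
  have : IsScalarTower K A L := IsScalarTower.of_algebraMap_eq fun _ => rfl
  let _ : Algebra (A ⧸ P) L :=
    ((algebraMap P.ResidueField L).comp (algebraMap (A ⧸ P) P.ResidueField)).toAlgebra
  have : IsScalarTower (A ⧸ P) P.ResidueField L := IsScalarTower.of_algebraMap_eq fun _ => rfl
  have hAL : ∀ a, algebraMap (A ⧸ P) L (Ideal.Quotient.mk P a) = algebraMap A L a := fun a => by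
    rw [IsScalarTower.algebraMap_apply A P.ResidueField L]
    rfl
  have : IsScalarTower K (A ⧸ P) L := IsScalarTower.of_algebraMap_eq fun x =>
    (hAL (algebraMap K A x)).symm
  have : Algebra.IsAlgebraic (A ⧸ P) L :=
    (IsFractionRing.comap_isAlgebraic_iff (K := P.ResidueField)).mpr inferInstance
  have : Algebra.EssFiniteType A L := Algebra.EssFiniteType.comp A P.ResidueField L
  have : Algebra.EssFiniteType K L := Algebra.EssFiniteType.comp K A L
  have hPL : Function.Injective (algebraMap (A ⧸ P) L) :=
    (algebraMap P.ResidueField L).injective.comp P.injective_algebraMap_quotient_residueField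
  obtain ⟨C, D, h⟩ := exists_bound_lift_of_isAlgebraic hPL
    ((Ideal.Quotient.mkₐ K P).comp π) ((Ideal.Quotient.mkₐ_surjective K P).comp hπ)
    ((σ.restrictScalars K).comp ρ)
  refine ⟨C, D, fun a g hag => ?_⟩
  obtain ⟨f, hf, hfd⟩ := h (Ideal.Quotient.mk P a) g (by
    rw [hAL, AlgHom.comp_apply, hag]
    exact σ.commutes a)
  exact ⟨f, Ideal.Quotient.eq.mp hf, hfd⟩

theorem exists_bound_lift_of_isReduced {K A B : Type u} {m l : ℕ} [Field K] [CommRing A]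
    [IsReduced A]
    [CommRing B] [Algebra K A] [Algebra K B] [Algebra A B] [IsScalarTower K A B]
    [Algebra.FiniteType K B] (hinj : Function.Injective (algebraMap A B))
    (π : MvPolynomial (Fin m) K →ₐ[K] A) (hπ : Function.Surjective π)
    (ρ : MvPolynomial (Fin l) K →ₐ[K] B) :
    ∃ C D : ℕ, ∀ a g, ρ g = algebraMap A B a →
      ∃ f, π f = a ∧ f.totalDegree ≤ C * g.totalDegree + D := by
  have : Algebra.FiniteType K A := Algebra.FiniteType.of_surjective π hπ
  have : IsNoetherianRing A := Algebra.FiniteType.isNoetherianRing K A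
  have := (minimalPrimes.finite_of_isNoetherianRing A).fintype
  let ι := minimalPrimes A
  choose C D h using fun P : ι => exists_bound_lift_mod_minimalPrime hinj π hπ ρ P.1 P.2
  have hgen : ∀ P : ι, ∃ (n : ℕ) (v : Fin n → MvPolynomial (Fin m) K),
      Ideal.span (Set.range v) = P.1.comap π := fun P =>
    Submodule.fg_iff_exists_fin_generating_family.mp (IsNoetherian.noetherian _)
  choose n v hv using hgen
  obtain ⟨E, hE⟩ := exists_bound_linear_system (K := K) (σ := Fin m) (ι := ι)
    (Sum.elim (fun _ : Unit => fun _ : ι => 1) fun t : (Σ P : ι, Fin (n P)) => Pi.single t.1 (v t.1 t.2))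
  have hsum : ∀ (c : Unit ⊕ (Σ P : ι, Fin (n P)) → MvPolynomial (Fin m) K) (P : ι),
      ∑ j, c j * (Sum.elim (fun _ : Unit => fun _ : ι => 1)
        (fun t : (Σ P : ι, Fin (n P)) => Pi.single t.1 (v t.1 t.2)) j : ι → MvPolynomial (Fin m) K) P =
        c (Sum.inl ()) + ∑ i, c (Sum.inr ⟨P, i⟩) * v P i := by
    intro c P
    rw [Fintype.sum_sum_type, Fintype.sum_sigma, Finset.sum_eq_single P]
    · simp
    · intro P' _ hne
      refine Finset.sum_eq_zero fun i _ => ?_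
      simp [Pi.single_eq_of_ne hne.symm]
    · simp
  simp only [hsum] at hE
  have hmem : ∀ (P : ι) (q : Fin (n P) → MvPolynomial (Fin m) K), π (∑ i, q i * v P i) ∈ P.1 := by
    intro P q
    rw [← Ideal.mem_comap, ← hv]
    exact Ideal.mem_span_range_iff_exists_fun.mpr ⟨q, rfl⟩
  refine ⟨∑ P, C P, ∑ P, D P + E, fun a g hag => ?_⟩
  choose r hr hrd using fun P => h P a g hag
  obtain ⟨f, rfl⟩ := hπ a
  have hc : ∀ P : ι, ∃ q : Fin (n P) → MvPolynomial (Fin m) K, ∑ i, q i * v P i = r P - f := by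
    intro P
    rw [← Ideal.mem_span_range_iff_exists_fun, hv, Ideal.mem_comap, map_sub]
    exact hr P
  choose q hq using hc
  obtain ⟨s, hs, hsd⟩ := hE ((∑ P, C P) * g.totalDegree + ∑ P, D P)
    (Sum.elim (fun _ => f) fun t => q t.1 t.2) (fun P => by
      simp only [Sum.elim_inl, Sum.elim_inr, hq, add_sub_cancel]
      have h1 := Finset.single_le_sum (f := C) (fun _ _ => Nat.zero_le _) (Finset.mem_univ P)
      have h2 := Finset.single_le_sum (f := D) (fun _ _ => Nat.zero_le _) (Finset.mem_univ P)
      exact (hrd P).trans (add_le_add (Nat.mul_le_mul_right _ h1) h2))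
  refine ⟨s (Sum.inl ()), ?_, (hsd _).trans (add_assoc _ _ _).le⟩
  rw [← sub_eq_zero]
  have hnil : π (s (Sum.inl ())) - π f ∈ sInf (minimalPrimes A) := by
    rw [Ideal.mem_sInf]
    intro P hP
    have h1 := hs ⟨P, hP⟩
    simp only [Sum.elim_inl, Sum.elim_inr, hq, add_sub_cancel] at h1
    have h2 := hmem ⟨P, hP⟩ fun i => s (Sum.inr ⟨⟨P, hP⟩, i⟩)
    have h3 := hr ⟨P, hP⟩
    have := P.sub_mem h3 h2
    rw [← h1, map_add] at this
    convert this using 1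
    ring
  rw [show sInf (minimalPrimes A) = (⊥ : Ideal A).radical from Ideal.sInf_minimalPrimes] at hnil
  obtain ⟨k, hk⟩ := hnil
  exact IsReduced.eq_zero _ ⟨k, hk⟩

end MvPolynomial

theorem exists_lift_of_le_admissiblePV {K A : Type*} [Field K] [CommRing A] [Algebra K A]
    {ν : A → EReal} {m : ℕ} (π : MvPolynomial (Fin m) K →ₐ[K] A) (d : Fin m → ℝ)
    (hd : ∀ i, 0 < d i)
    (hν : ∀ b : A, ν b = ⨆ (f : MvPolynomial (Fin m) K) (_ : π f = b),
      weightedDegPV (trivialPV K) d f) :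
    ∃ δ : ℝ, 0 < δ ∧ ∀ (a : A) (r : ℝ), r ≤ 0 → (r : EReal) ≤ ν a →
      ∃ f, π f = a ∧ (f.totalDegree : ℝ) * δ ≤ 1 - r := by
  obtain ⟨δ, hδ, hδd⟩ : ∃ δ : ℝ, 0 < δ ∧ ∀ i, δ ≤ d i := by
    rcases isEmpty_or_nonempty (Fin m) with h | h
    · exact ⟨1, one_pos, fun i => h.elim i⟩
    · obtain ⟨i, hi⟩ := Finite.exists_min d
      exact ⟨d i, hd i, hi⟩
  refine ⟨δ, hδ, fun a r hr hra => ?_⟩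
  have hlt : ((r - 1 : ℝ) : EReal) < ν a :=
    lt_of_lt_of_le (EReal.coe_lt_coe_iff.mpr (by linarith)) hra
  rw [hν, lt_iSup_iff] at hlt
  obtain ⟨f, hf⟩ := hlt
  obtain ⟨hfa, hf⟩ := lt_iSup_iff.mp hf
  refine ⟨f, hfa, ?_⟩
  rw [← le_div_iff₀ hδ]
  refine (Nat.le_floor_iff (div_nonneg (by linarith) hδ.le)).mp
    (Finset.sup_le fun k hk => Nat.le_floor ?_)
  have h1 := hf.trans_le (iInf_le _ k)
  rw [trivialPV, if_neg (MvPolynomial.mem_support_iff.mp hk), zero_sub, ← EReal.coe_neg,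
    EReal.coe_lt_coe_iff] at h1
  have h2 : (∑ i, (k i : ℝ)) * δ ≤ ∑ i, (k i : ℝ) * d i := by
    rw [Finset.sum_mul]
    exact Finset.sum_le_sum fun i _ => mul_le_mul_of_nonneg_left (hδd i) (Nat.cast_nonneg _)
  rw [le_div_iff₀ hδ, Finsupp.sum_fintype _ _ fun _ => rfl]
  push_cast
  linarith

theorem exists_neg_totalDegree_mul_le_admissiblePV {K A : Type*} [Field K] [CommRing A]
    [Algebra K A] {ν : A → EReal} {m : ℕ} (π : MvPolynomial (Fin m) K →ₐ[K] A) (d : Fin m → ℝ)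
    (hd : ∀ i, 0 < d i)
    (hν : ∀ b : A, ν b = ⨆ (f : MvPolynomial (Fin m) K) (_ : π f = b),
      weightedDegPV (trivialPV K) d f) :
    ∃ Δ : ℝ, 0 ≤ Δ ∧ ∀ f, ((-(f.totalDegree * Δ) : ℝ) : EReal) ≤ ν (π f) := by
  have hΔ : ∀ i, d i ≤ ∑ i, d i := fun i =>
    Finset.single_le_sum (fun i _ => (hd i).le) (Finset.mem_univ i)
  have hΔ0 : 0 ≤ ∑ i, d i := Finset.sum_nonneg fun i _ => (hd i).le
  refine ⟨∑ i, d i, hΔ0, fun f => ?_⟩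
  rw [hν]
  refine le_iSup₂_of_le f rfl (le_iInf fun k => ?_)
  rw [trivialPV]
  split_ifs with h
  · rw [EReal.top_sub_coe]
    exact le_top
  · rw [zero_sub, ← EReal.coe_neg, EReal.coe_le_coe_iff, neg_le_neg_iff]
    have h1 : (∑ i, (k i : ℝ)) ≤ f.totalDegree := by
      have := MvPolynomial.le_totalDegree (MvPolynomial.mem_support_iff.mpr h)
      rw [Finsupp.sum_fintype _ _ fun _ => rfl] at this
      exact_mod_cast this
    calc ∑ i, (k i : ℝ) * d i ≤ ∑ i, (k i : ℝ) * ∑ i, d i :=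
          Finset.sum_le_sum fun i _ => mul_le_mul_of_nonneg_left (hΔ i) (Nat.cast_nonneg _)
      _ = (∑ i, (k i : ℝ)) * ∑ i, d i := (Finset.sum_mul _ _ _).symm
      _ ≤ _ := mul_le_mul_of_nonneg_right h1 hΔ0

theorem exists_linear_bound_of_totalDegree_le {K A B : Type*} [Field K] [CommRing A] [CommRing B]
    [Algebra K A] [Algebra K B] {ν : A → EReal} {τ : B → EReal} {m l : ℕ}
    (π : MvPolynomial (Fin m) K →ₐ[K] A) (d : Fin m → ℝ) (hd : ∀ i, 0 < d i)
    (hν : ∀ b : A, ν b = ⨆ (f : MvPolynomial (Fin m) K) (_ : π f = b),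
      weightedDegPV (trivialPV K) d f)
    (ρ : MvPolynomial (Fin l) K →ₐ[K] B) (e : Fin l → ℝ) (he : ∀ i, 0 < e i)
    (hτ : ∀ b : B, τ b = ⨆ (f : MvPolynomial (Fin l) K) (_ : ρ f = b),
      weightedDegPV (trivialPV K) e f)
    (rel : A → B → Prop) (C D : ℕ) (h : ∀ a b, rel a b → ∀ f, π f = a →
      ∃ g, ρ g = b ∧ g.totalDegree ≤ C * f.totalDegree + D) :
    ∃ c E : ℝ, 0 < c ∧ 0 ≤ E ∧ ∀ a b, rel a b → ∀ r : ℝ, r ≤ 0 → (r : EReal) ≤ ν a →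
      ((c * r - E : ℝ) : EReal) ≤ τ b := by
  obtain ⟨δ, hδ, hlift⟩ := exists_lift_of_le_admissiblePV π d hd hν
  obtain ⟨Δ, hΔ, hle⟩ := exists_neg_totalDegree_mul_le_admissiblePV ρ e he hτ
  refine ⟨C / δ * Δ + 1, C / δ * Δ + D * Δ, by positivity, by positivity,
    fun a b hab r hr hra => ?_⟩
  obtain ⟨f, hf, hfd⟩ := hlift a r hr hra
  obtain ⟨g, rfl, hgd⟩ := h a b hab f hf
  refine le_trans (EReal.coe_le_coe_iff.mpr ?_) (hle g)
  have h1 : (g.totalDegree : ℝ) ≤ C * f.totalDegree + D := by exact_mod_cast hgd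
  have h2 : (f.totalDegree : ℝ) ≤ (1 - r) / δ := (le_div_iff₀ hδ).mpr hfd
  have h3 : (C : ℝ) * f.totalDegree ≤ C * ((1 - r) / δ) :=
    mul_le_mul_of_nonneg_left h2 (Nat.cast_nonneg _)
  have h4 : (g.totalDegree : ℝ) * Δ ≤ (C * ((1 - r) / δ) + D) * Δ :=
    mul_le_mul_of_nonneg_right (by linarith) hΔ
  have h5 : (C * ((1 - r) / δ) + D) * Δ = C / δ * Δ - C / δ * Δ * r + D * Δ := by ring
  linarith

theorem coe_le_add_coe_mul_iff (M n e : ℝ) (he : 0 < e) (v : EReal) :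
    (M : EReal) ≤ (n : EReal) + (e : EReal) * v ↔ (((M - n) / e : ℝ) : EReal) ≤ v := by
  induction v using EReal.rec with
  | bot => simp [EReal.coe_mul_bot_of_pos he]
  | coe v =>
    rw [← EReal.coe_mul, ← EReal.coe_add, EReal.coe_le_coe_iff, EReal.coe_le_coe_iff,
      div_le_iff₀ he, sub_le_iff_le_add', mul_comm e]
  | top => simp [EReal.coe_mul_top_of_pos he]

theorem isOverconvergent_iff_exists_le (p : ℕ) [Fact p.Prime] {A : Type*} [CommRing A]
    (ν : A → EReal) (α : WittVector p A) :
    IsOverconvergent p ν α ↔ ∃ ε M : ℝ, 0 < ε ∧ M ≤ 0 ∧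
      ∀ i : ℕ, (((M - i) / (ε * (p : ℝ) ^ (-(i : ℤ))) : ℝ) : EReal) ≤ ν (α.coeff i) := by
  have hp : (0 : ℝ) < p := Nat.cast_pos.mpr (Fact.out : p.Prime).pos
  have key : ∀ ε M : ℝ, 0 < ε → ((M : EReal) ≤ gaussNorm p ν ε α ↔
      ∀ i : ℕ, (((M - i) / (ε * (p : ℝ) ^ (-(i : ℤ))) : ℝ) : EReal) ≤ ν (α.coeff i)) := by
    intro ε M hε
    rw [gaussNorm, le_iInf_iff]
    refine forall_congr' fun i => ?_
    rw [← coe_le_add_coe_mul_iff _ _ _ (by positivity)]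
    rfl
  constructor
  · rintro ⟨ε, hε, h⟩
    obtain ⟨M, -, hM⟩ := EReal.lt_iff_exists_real_btwn.mp (bot_lt_iff_ne_bot.mpr h)
    refine ⟨ε, min M 0, hε, min_le_right _ _, (key ε _ hε).mp ?_⟩
    exact (EReal.coe_le_coe_iff.mpr (min_le_left M 0)).trans hM.le
  · rintro ⟨ε, M, hε, -, h⟩
    exact ⟨ε, hε, ne_bot_of_le_ne_bot (EReal.coe_ne_bot M) ((key ε M hε).mpr h)⟩

theorem IsOverconvergent.of_linear_bound {p : ℕ} [Fact p.Prime] {A B : Type*} [CommRing A]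
    [CommRing B] {ν : A → EReal} {τ : B → EReal} {α : WittVector p A} {β : WittVector p B}
    {c E : ℝ} (hc : 0 < c) (hE : 0 ≤ E)
    (h : ∀ (i : ℕ) (r : ℝ), r ≤ 0 → (r : EReal) ≤ ν (α.coeff i) →
      ((c * r - E : ℝ) : EReal) ≤ τ (β.coeff i))
    (hα : IsOverconvergent p ν α) : IsOverconvergent p τ β := by
  have hp : (0 : ℝ) < p := Nat.cast_pos.mpr (Fact.out : p.Prime).pos
  have hp1 : (1 : ℝ) ≤ p := by exact_mod_cast (Fact.out : p.Prime).one_le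
  rw [isOverconvergent_iff_exists_le] at hα ⊢
  obtain ⟨ε, M, hε, hM, hα⟩ := hα
  refine ⟨ε / c, M - ε * E / c, by positivity, ?_, fun i => ?_⟩
  · have : 0 ≤ ε * E / c := by positivity
    linarith
  · have hr : (M - i) / (ε * (p : ℝ) ^ (-(i : ℤ))) ≤ 0 :=
      div_nonpos_of_nonpos_of_nonneg (by linarith [(Nat.cast_nonneg i : (0 : ℝ) ≤ i)])
        (by positivity)
    refine (EReal.coe_le_coe_iff.mpr ?_).trans (h i _ hr (hα i))
    have h1 : (1 : ℝ) ≤ (p : ℝ) ^ i := one_le_pow₀ hp1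
    have h2 : (M - ε * E / c - i) / (ε / c * (p : ℝ) ^ (-(i : ℤ))) =
        c * ((M - i) / (ε * (p : ℝ) ^ (-(i : ℤ)))) - E * (p : ℝ) ^ i := by
      rw [zpow_neg, zpow_natCast]
      field_simp
      ring
    rw [h2]
    nlinarith

/-- Let `K` be a field of characteristic `p > 0`, `A` a smooth finitely
generated `K`-algebra, and `A → B` an injective homomorphism of finitely generated
`K`-algebras which is smooth.  With admissible pseudovaluations on `A` and `B`, a Witt
vector over `A` is overconvergent iff its image in `W(B)` is overconvergent. -/
theorem statement15 (p : ℕ) [Fact p.Prime] (K A B : Type u)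
    [Field K] [CharP K p] [CommRing A] [CommRing B]
    [Algebra K A] [Algebra K B] [Algebra A B] [IsScalarTower K A B]
    [Algebra.FiniteType K A] [Algebra.FiniteType K B]
    [Algebra.Smooth K A] [Algebra.Smooth A B]
    (hinj : Function.Injective (algebraMap A B))
    (ν : A → EReal) (hν : IsAdmissiblePV (trivialPV K) ν)
    (τ : B → EReal) (hτ : IsAdmissiblePV (trivialPV K) τ) :
    ∀ x : WittVector p A, IsOverconvergent p ν x ↔
      IsOverconvergent p τ (WittVector.map (algebraMap A B) x) := by
  have : IsReduced A := isReduced_of_smooth_field K A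
  obtain ⟨m, π, d, hπ, hd, hν⟩ := hν
  obtain ⟨l, ρ, e, hρ, he, hτ⟩ := hτ
  intro x
  constructor
  · choose t ht using fun i : Fin m => hρ (algebraMap A B (π (MvPolynomial.X i)))
    have hcomm : ∀ f, ρ (MvPolynomial.aeval t f) = algebraMap A B (π f) := by
      intro f
      have : ρ.comp (MvPolynomial.aeval t) = (IsScalarTower.toAlgHom K A B).comp π := by
        ext i
        simp [ht]
      exact DFunLike.congr_fun this f
    obtain ⟨c, E, hc, hE, h⟩ := exists_linear_bound_of_totalDegree_le π d hd hν ρ e he hτ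
      (fun a b => algebraMap A B a = b) (∑ i, (t i).totalDegree) 0 (by
        rintro _ _ rfl f rfl
        refine ⟨MvPolynomial.aeval t f, hcomm f, MvPolynomial.totalDegree_aeval_le t _
          (fun i => Finset.single_le_sum (f := fun i => (t i).totalDegree)
            (fun _ _ => Nat.zero_le _) (Finset.mem_univ i)) f⟩)
    exact IsOverconvergent.of_linear_bound hc hE fun i => h _ _ (WittVector.map_coeff _ x i).symm
  · obtain ⟨C, D, hCD⟩ := MvPolynomial.exists_bound_lift_of_isReduced hinj π hπ ρ
    obtain ⟨c, E, hc, hE, h⟩ := exists_linear_bound_of_totalDegree_le ρ e he hτ π d hd hν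
      (fun b a => algebraMap A B a = b) C D (by
        rintro b a rfl g hg
        exact hCD a g hg)
    exact IsOverconvergent.of_linear_bound hc hE fun i => h _ _ (WittVector.map_coeff _ x i).symm
end
end

section
/- Let K be a perfect field of characteristic p > 0 and let A be a finitely generated K-algebra equipped with an admissible pseudovaluation. Let f(T) ∈ W(A)[T] be a polynomial all of whose coefficients are overconvergent Witt vectors, and let f̄(T) ∈ A[T] be the polynomial obtained by applying the zeroth Witt component w₀ : W(A) → A to the coefficients of f. Let a ∈ A be such that f̄(a) = 0 and the derivative f̄'(a) is a unit in A. Then there exists a unique overconvergent Witt vector α ∈ W†(A) such that f(α) = 0 and w₀(α) = a. -/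
open scoped Classical

noncomputable section

namespace WittVector

variable {p : ℕ} [hp : Fact p.Prime] {R : Type*} [CommRing R]

theorem teichmuller_coeff_zero_add_verschiebung (x : WittVector p R) :
    teichmuller p (x.coeff 0) + verschiebung (x.shift 1) = x := by
  ext n
  rw [coeff_add_of_disjoint]
  · cases n with
    | zero => simp
    | succ n => simp [teichmuller_coeff_pos, shift_coeff, add_comm]
  · rintro (_ | n)
    · exact Or.inr (verschiebung_coeff_zero _)
    · exact Or.inl (teichmuller_coeff_pos _ _ _ n.succ_pos)

theorem frobenius_teichmuller [CharP R p] (r : R) :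
    frobenius (teichmuller p r) = teichmuller p (r ^ p) := by
  ext n
  rw [coeff_frobenius_charP]
  cases n with
  | zero => simp [-map_pow]
  | succ n => simp [-map_pow, teichmuller_coeff_pos, hp.out.ne_zero]

theorem teichmuller_mul_coeff [CharP R p] (r : R) (x : WittVector p R) (n : ℕ) :
    (teichmuller p r * x).coeff n = r ^ p ^ n * x.coeff n := by
  induction n generalizing r x with
  | zero => simp [mul_coeff_zero]
  | succ n ih =>
    conv_lhs => rw [← teichmuller_coeff_zero_add_verschiebung x]
    rw [mul_add, ← map_mul, mul_comm _ (verschiebung _), ← verschiebung_mul_frobenius,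
      frobenius_teichmuller, coeff_add_of_disjoint, teichmuller_coeff_pos _ _ _ n.succ_pos,
      verschiebung_coeff_succ, mul_comm, ih, zero_add, shift_coeff, ← pow_mul, pow_succ',
      add_comm 1 n]
    rintro (_ | n)
    · exact Or.inr (verschiebung_coeff_zero _)
    · exact Or.inl (teichmuller_coeff_pos _ _ _ n.succ_pos)

theorem coeff_eq_of_sub_mem_ker_truncate {n i : ℕ} (hi : i < n) {x y : WittVector p R}
    (h : x - y ∈ RingHom.ker (truncate n : WittVector p R →+* _)) : x.coeff i = y.coeff i := by
  rw [RingHom.sub_mem_ker_iff] at h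
  simpa using congrArg (TruncatedWittVector.coeff ⟨i, hi⟩) h

theorem mul_mem_ker_truncate_succ [CharP R p] {n : ℕ} {x y : WittVector p R}
    (hx : x.coeff 0 = 0) (hy : y ∈ RingHom.ker (truncate n : WittVector p R →+* _)) :
    x * y ∈ RingHom.ker (truncate (n + 1) : WittVector p R →+* _) := by
  have hx' : x = verschiebung (x.shift 1) := by
    simpa [hx] using (teichmuller_coeff_zero_add_verschiebung x).symm
  have hF : frobenius y ∈ RingHom.ker (truncate n : WittVector p R →+* _) := by
    rw [mem_ker_truncate] at hy ⊢
    intro i hi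
    rw [coeff_frobenius_charP, hy i hi, zero_pow hp.out.ne_zero]
  have h := Ideal.mul_mem_left _ (x.shift 1) hF
  rw [mem_ker_truncate] at h ⊢
  rw [hx', ← verschiebung_mul_frobenius]
  rintro (_ | i) hi
  · exact verschiebung_coeff_zero _
  · rw [verschiebung_coeff_succ]
    exact h i (by lia)

theorem eq_zero_of_mul_eq_zero_of_isUnit_coeff_zero [CharP R p] {x y : WittVector p R}
    (hx : IsUnit (x.coeff 0)) (hxy : x * y = 0) : y = 0 := by
  obtain ⟨u, hu⟩ := hx.exists_left_inv
  have hz : (1 - teichmuller p u * x).coeff 0 = 0 := by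
    have := map_sub (constantCoeff : WittVector p R →+* R) 1 (teichmuller p u * x)
    rw [map_one, map_mul] at this
    simpa [constantCoeff_apply, hu] using this
  have hy : y = (1 - teichmuller p u * x) * y := by
    rw [sub_mul, mul_assoc, hxy, mul_zero, one_mul, sub_zero]
  have h : ∀ n, y ∈ RingHom.ker (truncate n : WittVector p R →+* _) := by
    intro n
    induction n with
    | zero => rw [mem_ker_truncate]; simp
    | succ n ih => rw [hy]; exact mul_mem_ker_truncate_succ hz ih
  ext n
  simpa using (mem_ker_truncate (n + 1) y).1 (h _) n n.lt_succ_self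

end WittVector

/-- An exhaustive decreasing multiplicative filtration of a ring, indexed by the reals. -/
structure RealFiltration (A : Type*) [CommRing A] where
  /-- The pieces of the filtration. -/
  N : ℝ → AddSubgroup A
  anti : Antitone N
  one_mem : 1 ∈ N 0
  mul_mem : ∀ {r s : ℝ} {a b : A}, a ∈ N r → b ∈ N s → a * b ∈ N (r + s)
  exhaustive : ∀ a : A, ∃ r, a ∈ N r

namespace RealFiltration

open WittVector

variable {A : Type*} [CommRing A] (F : RealFiltration A)

theorem pow_mem {r : ℝ} {a : A} (h : a ∈ F.N r) (n : ℕ) : a ^ n ∈ F.N (r * n) := by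
  induction n with
  | zero => simpa using F.one_mem
  | succ n ih =>
    rw [pow_succ, Nat.cast_add, Nat.cast_one, mul_add, mul_one]
    exact F.mul_mem ih h

/-- The Rees ring of slope `s`: polynomials whose `k`-th coefficient has level `s * k`. -/
def rees (s : ℝ) : Subring (Polynomial A) where
  carrier := {f | ∀ k : ℕ, f.coeff k ∈ F.N (s * k)}
  zero_mem' k := by simp
  one_mem' k := by
    rw [Polynomial.coeff_one]
    split_ifs with h
    · simpa [h] using F.one_mem
    · exact zero_mem _
  add_mem' hf hg k := by
    rw [Polynomial.coeff_add]
    exact add_mem (hf k) (hg k)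
  neg_mem' hf k := by
    rw [Polynomial.coeff_neg]
    exact neg_mem (hf k)
  mul_mem' hf hg k := by
    rw [Polynomial.coeff_mul]
    refine sum_mem fun x hx => ?_
    have h := F.mul_mem (hf x.1) (hg x.2)
    rwa [← mul_add, ← Nat.cast_add, Finset.HasAntidiagonal.mem_antidiagonal.1 hx] at h

variable {p : ℕ} [hp : Fact p.Prime]

theorem exists_rees_lift [CharP A p] {s : ℝ} {n : ℕ} {x : WittVector p A}
    (hx : ∀ i ≤ n, x.coeff i ∈ F.N (s * (p ^ i : ℕ))) :
    ∃ y : WittVector p (F.rees s), map (F.rees s).subtype y =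
      teichmuller p Polynomial.X * map Polynomial.C (init (n + 1) x) := by
  refine ⟨WittVector.mk p fun i => ⟨Polynomial.monomial (p ^ i) ((init (n + 1) x).coeff i), fun k => ?_⟩, ?_⟩
  · rw [Polynomial.coeff_monomial]
    split_ifs with h
    · simp only [← h, WittVector.init, select, coeff_mk]
      split_ifs with hi
      · exact hx i (by lia)
      · exact zero_mem _
    · exact zero_mem _
  · ext i
    rw [teichmuller_mul_coeff, map_coeff, map_coeff, mul_comm, Polynomial.C_mul_X_pow_eq_monomial]
    rfl

theorem sub_coeff_mem [CharP A p] {s : ℝ} {n : ℕ} {x y : WittVector p A}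
    (hx : ∀ i ≤ n, x.coeff i ∈ F.N (s * (p ^ i : ℕ)))
    (hy : ∀ i ≤ n, y.coeff i ∈ F.N (s * (p ^ i : ℕ))) :
    (x - y).coeff n ∈ F.N (s * (p ^ n : ℕ)) := by
  obtain ⟨x', hx'⟩ := F.exists_rees_lift hx
  obtain ⟨y', hy'⟩ := F.exists_rees_lift hy
  have hc : ∀ z : WittVector p A, (init (n + 1) z).coeff n = z.coeff n := fun z => by
    simp [WittVector.init, select]
  have h := congrArg (coeff · n) (map_sub (map (F.rees s).subtype) x' y')
  simp only [hx', hy', ← mul_sub, ← map_sub, teichmuller_mul_coeff, map_coeff] at h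
  have hm := ((x' - y').coeff n).2 (p ^ n)
  rw [Subring.subtype_apply] at h
  rw [h, mul_comm (Polynomial.X ^ _), Polynomial.coeff_C_mul, Polynomial.coeff_X_pow, if_pos rfl, mul_one] at hm
  rwa [← hc, init_sub, hc]

theorem sub_coeff_mem_of_le [CharP A p] {c g : ℝ} (hc : 0 ≤ c) {n : ℕ} {x y : WittVector p A}
    (hx : ∀ i ≤ n, x.coeff i ∈ F.N (c * (g - i) * (p ^ i : ℕ)))
    (hy : ∀ i ≤ n, y.coeff i ∈ F.N (c * (g - i) * (p ^ i : ℕ))) :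
    (x - y).coeff n ∈ F.N (c * (g - n) * (p ^ n : ℕ)) :=
  F.sub_coeff_mem (fun i hi => F.anti (by gcongr) (hx i hi))
    (fun i hi => F.anti (by gcongr) (hy i hi))

variable (p) in
/-- Witt vectors of Gauss norm at least `g`, where `c` is the inverse of the radius. -/
noncomputable def gauss [CharP A p] (c : ℝ) (hc : 0 ≤ c) (g : ℝ) : AddSubgroup (WittVector p A) :=
  AddSubgroup.ofSub {x | ∀ i : ℕ, x.coeff i ∈ F.N (c * (g - i) * (p ^ i : ℕ))}
    ⟨0, fun i => by simp⟩ (by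
      intro x hx y hy n
      rw [← sub_eq_add_neg]
      exact F.sub_coeff_mem_of_le hc (fun i _ => hx i) (fun i _ => hy i))

section gauss

variable [CharP A p] {c : ℝ} {hc : 0 ≤ c} {g h : ℝ}

theorem mem_gauss {x : WittVector p A} :
    x ∈ F.gauss p c hc g ↔ ∀ i : ℕ, x.coeff i ∈ F.N (c * (g - i) * (p ^ i : ℕ)) :=
  Iff.rfl

theorem gauss_anti : Antitone (F.gauss p c hc) := fun _ _ hgh _ hx i =>
  F.anti (by gcongr) (hx i)

theorem teichmuller_mem_gauss {a : A} (ha : a ∈ F.N (c * g)) :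
    teichmuller p a ∈ F.gauss p c hc g := by
  rintro (_ | i)
  · simpa using ha
  · rw [teichmuller_coeff_pos _ _ _ i.succ_pos]
    exact zero_mem _

theorem one_mem_gauss : (1 : WittVector p A) ∈ F.gauss p c hc 0 := by
  rw [← map_one (teichmuller p)]
  exact F.teichmuller_mem_gauss (by simpa using F.one_mem)

theorem mul_mem_gauss {x y : WittVector p A} (hx : x ∈ F.gauss p c hc g)
    (hy : y ∈ F.gauss p c hc h) : x * y ∈ F.gauss p c hc (g + h) := by
  intro n
  induction n using Nat.strong_induction_on generalizing c g x y with
  | _ n ih =>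
  have hp0 : (0 : ℝ) ≤ p := p.cast_nonneg
  have h1 : teichmuller p (x.coeff 0) * y ∈ F.gauss p c hc (g + h) := by
    intro i
    rw [teichmuller_mul_coeff]
    convert F.mul_mem (F.pow_mem (hx 0) (p ^ i)) (hy i) using 2
    simp; ring
  have hx' : -x.shift 1 ∈ F.gauss p (c * p) (mul_nonneg hc hp0) (g - 1) := by
    refine neg_mem fun i => ?_
    rw [shift_coeff]
    convert hx (1 + i) using 2
    push_cast; ring
  have hy' : frobenius y ∈ F.gauss p (c * p) (mul_nonneg hc hp0) h := by
    intro i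
    rw [coeff_frobenius_charP]
    convert F.pow_mem (hy i) p using 2
    push_cast; ring
  have h2 : ∀ i ≤ n, (verschiebung (-x.shift 1) * y).coeff i ∈
      F.N (c * (g + h - i) * (p ^ i : ℕ)) := by
    rintro (_ | i) hi
    · rw [mul_coeff_zero, verschiebung_coeff_zero, zero_mul]
      exact zero_mem _
    · rw [← verschiebung_mul_frobenius, verschiebung_coeff_succ]
      convert ih i hi hx' hy' using 2
      push_cast; ring
  have hxy : x * y = teichmuller p (x.coeff 0) * y - verschiebung (-x.shift 1) * y := by
    conv_lhs => rw [← teichmuller_coeff_zero_add_verschiebung x]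
    rw [map_neg, neg_mul, sub_neg_eq_add, add_mul]
  rw [hxy]
  exact F.sub_coeff_mem_of_le hc (fun i _ => h1 i) h2

theorem pow_mem_gauss_zero {x : WittVector p A} (hx : x ∈ F.gauss p c hc 0) (n : ℕ) :
    x ^ n ∈ F.gauss p c hc 0 := by
  induction n with
  | zero => simpa using F.one_mem_gauss
  | succ n ih => simpa [pow_succ] using F.mul_mem_gauss ih hx

theorem eval_mem_gauss {P : Polynomial (WittVector p A)} {x : WittVector p A}
    (hP : ∀ k, P.coeff k ∈ F.gauss p c hc g) (hx : x ∈ F.gauss p c hc 0) :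
    P.eval x ∈ F.gauss p c hc g := by
  rw [Polynomial.eval_eq_sum_range]
  exact sum_mem fun k _ => by simpa using F.mul_mem_gauss (hP k) (F.pow_mem_gauss_zero hx k)

end gauss

section overconvergent

variable [CharP A p]

theorem gauss_le_gauss {c c' g g' : ℝ} {hc : 0 ≤ c} {hc' : 0 ≤ c'} (h : c ≤ c') (hg : g' ≤ g)
    (hg' : g' ≤ 0) : F.gauss p c hc g ≤ F.gauss p c' hc' g' := fun x hx i =>
  F.anti (by
    have : (0 : ℝ) ≤ i := i.cast_nonneg
    gcongr ?_ * _
    nlinarith) (hx i)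

variable (p) in
/-- The ring of overconvergent Witt vectors. -/
noncomputable def overconvergent : Subring (WittVector p A) where
  carrier := {x | ∃ (c : ℝ) (hc : 0 ≤ c), x ∈ F.gauss p c hc (-c)}
  zero_mem' := ⟨0, le_rfl, zero_mem _⟩
  one_mem' := ⟨0, le_rfl, by simpa using F.one_mem_gauss⟩
  neg_mem' := fun ⟨c, hc, h⟩ => ⟨c, hc, neg_mem h⟩
  add_mem' := by
    rintro x y ⟨c, hc, hx⟩ ⟨d, hd, hy⟩
    refine ⟨c + d, add_nonneg hc hd, add_mem ?_ ?_⟩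
    · exact F.gauss_le_gauss (by linarith) (by linarith) (by linarith) hx
    · exact F.gauss_le_gauss (by linarith) (by linarith) (by linarith) hy
  mul_mem' := by
    rintro x y ⟨c, hc, hx⟩ ⟨d, hd, hy⟩
    have hcd := add_nonneg hc hd
    refine ⟨c + d, hcd, ?_⟩
    have hx' : x ∈ F.gauss p (c + d) hcd (-c) :=
      F.gauss_le_gauss (by linarith) (by linarith) (by linarith) hx
    have hy' : y ∈ F.gauss p (c + d) hcd (-d) :=
      F.gauss_le_gauss (by linarith) (by linarith) (by linarith) hy
    convert F.mul_mem_gauss hx' hy' using 1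
    congr 1
    ring

theorem mem_overconvergent_of_mem_gauss {c g : ℝ} {hc : 0 ≤ c} {x : WittVector p A}
    (hx : x ∈ F.gauss p c hc g) : x ∈ F.overconvergent p :=
  ⟨max c (-g), hc.trans (le_max_left _ _), F.gauss_le_gauss (le_max_left _ _)
    (neg_le.1 (le_max_right _ _)) (neg_nonpos.2 (hc.trans (le_max_left _ _))) hx⟩

theorem teichmuller_mem_overconvergent (a : A) : teichmuller p a ∈ F.overconvergent p := by
  obtain ⟨r, hr⟩ := F.exhaustive a
  exact F.mem_overconvergent_of_mem_gauss (c := 1) (hc := zero_le_one) (g := r)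
    (F.teichmuller_mem_gauss (by simpa using hr))

theorem exists_forall_coeff_mem_gauss {P : Polynomial (WittVector p A)}
    (hP : ∀ k, P.coeff k ∈ F.overconvergent p) :
    ∃ (c : ℝ) (hc : 0 ≤ c), ∀ k, P.coeff k ∈ F.gauss p c hc (-c) := by
  choose c hc h using hP
  have hs := Finset.sum_nonneg (s := P.support) fun k _ => hc k
  refine ⟨∑ k ∈ P.support, c k, hs, fun k => ?_⟩
  by_cases hk : k ∈ P.support
  · have hle := Finset.single_le_sum (fun k _ => hc k) hk
    exact F.gauss_le_gauss hle (neg_le_neg hle) (neg_nonpos.2 hs) (h k)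
  · rw [Polynomial.notMem_support_iff.1 hk]
    exact zero_mem _

theorem mem_gauss_neg_half {c : ℝ} {hc : 0 ≤ c} (hc' : 0 ≤ 2 * (1 + c) * c)
    {x : WittVector p A} (hx : x ∈ F.gauss p c hc (-c)) :
    x ∈ F.gauss p (2 * (1 + c) * c) hc' (-(1 / 2)) := fun i =>
  F.anti (by
    have : (0 : ℝ) ≤ i := i.cast_nonneg
    gcongr ?_ * _
    rw [mul_comm _ c, mul_assoc]
    gcongr c * ?_
    nlinarith) (hx i)

theorem mem_gauss_half {c : ℝ} {hc : 0 ≤ c} (hc' : 0 ≤ 2 * (1 + c) * c)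
    {x : WittVector p A} (hx : x ∈ F.gauss p c hc (-c)) (h0 : x.coeff 0 = 0) :
    x ∈ F.gauss p (2 * (1 + c) * c) hc' (1 / 2) := by
  rintro (_ | i)
  · rw [h0]
    exact zero_mem _
  · refine F.anti ?_ (hx (i + 1))
    have : (0 : ℝ) ≤ i := i.cast_nonneg
    gcongr ?_ * _
    rw [mul_comm _ c, mul_assoc]
    gcongr c * ?_
    push_cast
    nlinarith

end overconvergent

end RealFiltration

namespace WittVector

open Polynomial

variable {p : ℕ} [hp : Fact p.Prime] {R : Type*} [CommRing R] [CharP R p]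

theorem eq_of_eval_eq_zero_of_isUnit_derivative {f : (WittVector p R)[X]} {x y : WittVector p R}
    (hx : f.eval x = 0) (hy : f.eval y = 0) (hxy : x.coeff 0 = y.coeff 0)
    (hu : IsUnit ((derivative f).eval x |>.coeff 0)) : x = y := by
  obtain ⟨r, hr⟩ := f.binomExpansion x (y - x)
  rw [add_sub_cancel, hx, hy, zero_add, sq, ← mul_assoc, ← add_mul] at hr
  have hc : WittVector.constantCoeff (y - x) = 0 := by
    rw [map_sub]
    simp [WittVector.constantCoeff, hxy]
  have hu' : IsUnit (((derivative f).eval x + r * (y - x)).coeff 0) := by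
    change IsUnit (WittVector.constantCoeff ((derivative f).eval x + r * (y - x)))
    rw [map_add, map_mul, hc, mul_zero, add_zero]
    exact hu
  exact (sub_eq_zero.1 (eq_zero_of_mul_eq_zero_of_isUnit_coeff_zero hu' hr.symm)).symm

theorem eval_sub_eval_mem_ker_truncate_succ {P : (WittVector p R)[X]}
    (h1 : (P.coeff 1).coeff 0 = 0) {n : ℕ} {x y : WittVector p R} (hx : x.coeff 0 = 0)
    (hy : y.coeff 0 = 0)
    (hxy : x - y ∈ RingHom.ker (truncate n : WittVector p R →+* _)) :
    P.eval x - P.eval y ∈ RingHom.ker (truncate (n + 1) : WittVector p R →+* _) := by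
  have hQ : (P.divX.eval x).coeff 0 = 0 := by
    change (WittVector.constantCoeff : WittVector p R →+* R) _ = 0
    rw [← eval_map_apply, show WittVector.constantCoeff x = 0 from hx, ← coeff_zero_eq_eval_zero, coeff_map,
      coeff_divX]
    exact h1
  have hP : ∀ z, P.eval z = P.divX.eval z * z + P.coeff 0 := fun z => by
    conv_lhs => rw [← P.divX_mul_X_add]
    simp
  have key : P.eval x - P.eval y =
      P.divX.eval x * (x - y) + y * (P.divX.eval x - P.divX.eval y) := by
    rw [hP, hP]; ring
  rw [key]
  exact add_mem (mul_mem_ker_truncate_succ hQ hxy) (mul_mem_ker_truncate_succ hy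
    (Ideal.mem_of_dvd _ (sub_dvd_eval_sub x y _) hxy))

/-- A polynomial self-map of the kernel of the zeroth component whose linear coefficient
vanishes modulo that kernel has a fixed point, each of whose components is attained by the
iterates of zero. -/
theorem exists_eval_eq_self {P : (WittVector p R)[X]} (h0 : (P.coeff 0).coeff 0 = 0)
    (h1 : (P.coeff 1).coeff 0 = 0) :
    ∃ x : WittVector p R, P.eval x = x ∧
      ∀ i, x.coeff i = ((fun z => P.eval z)^[i + 1] 0).coeff i := by
  set t : ℕ → WittVector p R := fun n => (fun z => P.eval z)^[n] 0 with ht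
  have hts : ∀ n, t (n + 1) = P.eval (t n) := fun n => Function.iterate_succ_apply' _ _ _
  have hP0 : ∀ z : WittVector p R, z.coeff 0 = 0 → (P.eval z).coeff 0 = 0 := by
    intro z hz
    change (WittVector.constantCoeff : WittVector p R →+* R) _ = 0
    rw [← eval_map_apply, show WittVector.constantCoeff z = 0 from hz, ← coeff_zero_eq_eval_zero, coeff_map]
    exact h0
  have ht0 : ∀ n, (t n).coeff 0 = 0 := by
    intro n
    induction n with
    | zero => exact zero_coeff p R 0
    | succ n ih => rw [hts]; exact hP0 _ ih
  have hstep : ∀ n, t (n + 1) - t n ∈ RingHom.ker (truncate n : WittVector p R →+* _) := by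
    intro n
    induction n with
    | zero => rw [mem_ker_truncate]; simp
    | succ n ih =>
      rw [hts (n + 1)]
      nth_rw 2 [hts n]
      exact eval_sub_eval_mem_ker_truncate_succ h1 (ht0 _) (ht0 _) ih
  have hstab : ∀ n m i, i < n → (t (n + m)).coeff i = (t n).coeff i := by
    intro n m i hi
    induction m with
    | zero => rfl
    | succ m ih =>
      rw [← ih, ← add_assoc]
      exact coeff_eq_of_sub_mem_ker_truncate (lt_of_lt_of_le hi (n.le_add_right m)) (hstep _)
  set x : WittVector p R := WittVector.mk p fun i => (t (i + 1)).coeff i with hx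
  have hxt : ∀ n, x - t n ∈ RingHom.ker (truncate n : WittVector p R →+* _) := by
    intro n
    rw [RingHom.sub_mem_ker_iff]
    ext i
    rw [coeff_truncate, coeff_truncate, hx, coeff_mk]
    obtain ⟨m, hm⟩ := Nat.exists_eq_add_of_le (Nat.succ_le_of_lt i.2)
    exact (hm ▸ hstab _ m _ (Nat.lt_succ_self _)).symm
  have hx0 : x.coeff 0 = 0 := ht0 1
  refine ⟨x, ?_, fun i => rfl⟩
  ext n
  have h := eval_sub_eval_mem_ker_truncate_succ h1 hx0 (ht0 n) (hxt n)
  rw [← hts] at h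
  rw [coeff_eq_of_sub_mem_ker_truncate n.lt_succ_self h,
    coeff_eq_of_sub_mem_ker_truncate n.lt_succ_self (hxt (n + 1))]

end WittVector

namespace RealFiltration

open WittVector Polynomial

variable {A : Type*} [CommRing A] (F : RealFiltration A) {p : ℕ} [hp : Fact p.Prime] [CharP A p]

theorem eval_mem_gauss_half {P : (WittVector p A)[X]} {c : ℝ} {hc : 0 ≤ c}
    (hP : ∀ k, P.coeff k ∈ F.gauss p c hc (-(1 / 2)))
    (h0 : P.coeff 0 ∈ F.gauss p c hc (1 / 2)) (h1 : P.coeff 1 ∈ F.gauss p c hc (1 / 2))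
    {x : WittVector p A} (hx : x ∈ F.gauss p c hc (1 / 2)) :
    P.eval x ∈ F.gauss p c hc (1 / 2) := by
  have hx0 : x ∈ F.gauss p c hc 0 := F.gauss_anti (by norm_num) hx
  have hdec : P.eval x = P.divX.divX.eval x * (x * x) + P.coeff 1 * x + P.coeff 0 := by
    conv_lhs => rw [← P.divX_mul_X_add, ← P.divX.divX_mul_X_add, coeff_divX]
    simp; ring
  have hq : P.divX.divX.eval x ∈ F.gauss p c hc (-(1 / 2)) :=
    F.eval_mem_gauss (fun k => by simpa only [coeff_divX] using hP _) hx0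
  rw [hdec]
  refine add_mem (add_mem ?_ ?_) h0
  · exact F.gauss_anti (by norm_num) (F.mul_mem_gauss hq (F.mul_mem_gauss hx hx))
  · exact F.gauss_anti (by norm_num) (F.mul_mem_gauss h1 hx)

theorem exists_overconvergent_eval_eq_self {P : (WittVector p A)[X]}
    (hP : ∀ k, P.coeff k ∈ F.overconvergent p) (h0 : (P.coeff 0).coeff 0 = 0)
    (h1 : (P.coeff 1).coeff 0 = 0) :
    ∃ x ∈ F.overconvergent p, P.eval x = x ∧ x.coeff 0 = 0 := by
  obtain ⟨c, hc, hPc⟩ := F.exists_forall_coeff_mem_gauss hP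
  have hc' : 0 ≤ 2 * (1 + c) * c := by positivity
  obtain ⟨x, hx, hxi⟩ := exists_eval_eq_self h0 h1
  have hit : ∀ n, (fun z => P.eval z)^[n] 0 ∈ F.gauss p (2 * (1 + c) * c) hc' (1 / 2) := by
    intro n
    induction n with
    | zero => exact zero_mem _
    | succ n ih =>
      rw [Function.iterate_succ_apply']
      exact F.eval_mem_gauss_half (fun k => F.mem_gauss_neg_half hc' (hPc k))
        (F.mem_gauss_half hc' (hPc 0) h0) (F.mem_gauss_half hc' (hPc 1) h1) ih
  refine ⟨x, F.mem_overconvergent_of_mem_gauss (c := 2 * (1 + c) * c) (hc := hc') (g := 1 / 2)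
    fun i => ?_, hx, ?_⟩
  · rw [hxi]
    exact hit (i + 1) i
  · rw [hxi, Function.iterate_one, ← coeff_zero_eq_eval_zero, h0]

theorem exists_overconvergent_root {f : (WittVector p A)[X]}
    (hf : ∀ k, f.coeff k ∈ F.overconvergent p) {a : A}
    (ha : (f.map WittVector.constantCoeff).eval a = 0)
    (ha' : IsUnit ((derivative (f.map WittVector.constantCoeff)).eval a)) :
    ∃ x ∈ F.overconvergent p, f.eval x = 0 ∧ x.coeff 0 = a := by
  obtain ⟨u, hu⟩ := ha'.exists_left_inv
  set T : A → WittVector p A := fun b => teichmuller p b with hT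
  have hTO : ∀ b, T b ∈ F.overconvergent p := F.teichmuller_mem_overconvergent
  have hT0 : ∀ b, constantCoeff (T b) = b := fun b => teichmuller_coeff_zero p b
  set q : (WittVector p A)[X] := f.comp (X + C (T a)) with hq
  have hqO : ∀ k, q.coeff k ∈ F.overconvergent p := by
    have hlift : f ∈ lifts (F.overconvergent p).subtype := (lifts_iff_coeff_lifts f).2 fun k =>
      ⟨⟨_, hf k⟩, rfl⟩
    obtain ⟨g, rfl⟩ := hlift
    intro k
    have : q = (g.comp (X + C ⟨T a, hTO a⟩)).map (F.overconvergent p).subtype := by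
      simp [hq, Polynomial.map_comp]
    rw [this, coeff_map]
    exact Subtype.property _
  have hq0 : WittVector.constantCoeff (q.coeff 0) = 0 := by
    rw [← coeff_map, coeff_zero_eq_eval_zero]
    simpa [hq, Polynomial.map_comp, hT0] using ha
  have hq1 : u * WittVector.constantCoeff (q.coeff 1) = 1 := by
    have h : (derivative (q.map WittVector.constantCoeff)).eval 0 = WittVector.constantCoeff (q.coeff 1) := by
      rw [← coeff_zero_eq_eval_zero, coeff_derivative]
      simp
    rw [← h, ← hu]
    simp [hq, Polynomial.map_comp, hT0, derivative_comp]
  set P : (WittVector p A)[X] := X - C (T u) * q with hPdef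
  have hPO : ∀ k, P.coeff k ∈ F.overconvergent p := by
    intro k
    rw [hPdef, coeff_sub, coeff_C_mul, coeff_X]
    refine Subring.sub_mem _ ?_ (Subring.mul_mem _ (hTO u) (hqO k))
    split_ifs
    exacts [Subring.one_mem _, Subring.zero_mem _]
  have hP0 : WittVector.constantCoeff (P.coeff 0) = 0 := by
    rw [hPdef, coeff_sub, coeff_C_mul, coeff_X_zero, map_sub, map_mul, hq0]
    simp
  have hP1 : WittVector.constantCoeff (P.coeff 1) = 0 := by
    rw [hPdef, coeff_sub, coeff_C_mul, coeff_X_one, map_sub, map_mul, hT0, hq1]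
    simp
  obtain ⟨x, hxO, hx, hx0⟩ := F.exists_overconvergent_eval_eq_self hPO hP0 hP1
  refine ⟨x + T a, add_mem hxO (hTO a), ?_, ?_⟩
  · have h : T u * q.eval x = 0 := by
      rw [hPdef, eval_sub, eval_X, eval_mul, eval_C] at hx
      exact sub_eq_self.1 hx
    have hu' : IsUnit ((T u).coeff 0) := by
      rw [hT, teichmuller_coeff_zero]
      exact IsUnit.of_mul_eq_one _ hu
    simpa [hq] using eq_zero_of_mul_eq_zero_of_isUnit_coeff_zero hu' h
  · change WittVector.constantCoeff (x + T a) = a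
    rw [map_add, hT0, show WittVector.constantCoeff x = 0 from hx0, zero_add]

end RealFiltration

section Admissible

variable {K : Type*} [Field K]

theorem coe_le_weightedDegPV_iff {m : ℕ} {d : Fin m → ℝ} {r : ℝ}
    {f : MvPolynomial (Fin m) K} :
    (r : EReal) ≤ weightedDegPV (trivialPV K) d f ↔
      ∀ k ∈ f.support, r ≤ -∑ i, (k i : ℝ) * d i := by
  rw [weightedDegPV, le_iInf_iff]
  refine forall_congr' fun k => ?_
  by_cases h : MvPolynomial.coeff k f = 0
  · simp [trivialPV, h]
  · simp only [trivialPV, h, if_false, MvPolynomial.mem_support_iff, ne_eq, not_false_eq_true,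
      forall_const, zero_sub]
    norm_cast

variable {A : Type*} [CommRing A] [Algebra K A] {τ : A → EReal}

/-- The filtration of `A` by level sets of an admissible pseudovaluation. -/
theorem IsAdmissiblePV.exists_realFiltration (hτ : IsAdmissiblePV (trivialPV K) τ) :
    ∃ F : RealFiltration A, ∀ (r : ℝ) (a : A), a ∈ F.N r ↔ (r : EReal) ≤ τ a := by
  obtain ⟨m, π, d, hπ, -, hτ⟩ := hτ
  set D : ℝ → A → Prop := fun r a => ∃ f : MvPolynomial (Fin m) K, π f = a ∧
    ∀ k ∈ f.support, r ≤ -∑ i, (k i : ℝ) * d i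
  have hle : ∀ {r a}, D r a → (r : EReal) ≤ τ a := by
    rintro r a ⟨f, hf, h⟩
    rw [hτ]
    exact le_iSup₂_of_le f hf (coe_le_weightedDegPV_iff.2 h)
  have hlt : ∀ {r : ℝ} {a}, (r : EReal) < τ a → D r a := by
    intro r a h
    rw [hτ] at h
    obtain ⟨f, h⟩ := lt_iSup_iff.1 h
    obtain ⟨hf, h⟩ := lt_iSup_iff.1 h
    exact ⟨f, hf, coe_le_weightedDegPV_iff.1 h.le⟩
  have hiff : ∀ {r : ℝ} {a}, (r : EReal) ≤ τ a ↔ ∀ s < r, D s a := by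
    refine fun {r a} => ⟨fun h s hs => hlt ((EReal.coe_lt_coe_iff.2 hs).trans_le h), fun h => ?_⟩
    refine EReal.ge_of_forall_gt_iff_ge.1 fun s hs => hle (h s (EReal.coe_lt_coe_iff.1 hs))
  refine ⟨{
    N := fun r => AddSubgroup.ofSub {a | (r : EReal) ≤ τ a} ⟨0, ?_⟩ ?_
    anti := fun r s hrs a ha => (EReal.coe_le_coe_iff.2 hrs).trans ha
    one_mem := ?_
    mul_mem := ?_
    exhaustive := ?_ }, fun r a => Iff.rfl⟩
  · exact hle ⟨0, map_zero _, by simp⟩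
  · intro a ha b hb
    rw [← sub_eq_add_neg]
    refine hiff.2 fun s hs => ?_
    obtain ⟨f, rfl, hf⟩ := hiff.1 ha s hs
    obtain ⟨g, rfl, hg⟩ := hiff.1 hb s hs
    refine ⟨f - g, map_sub _ _ _, fun k hk => ?_⟩
    rcases Finset.mem_union.1 (MvPolynomial.support_sub _ f g hk) with h | h
    exacts [hf k h, hg k h]
  · refine hle ⟨1, map_one _, fun k hk => ?_⟩
    have : k = 0 := by simpa using hk
    simp [this]
  · intro r s a b ha hb
    refine hiff.2 fun t ht => ?_
    obtain ⟨f, rfl, hf⟩ := hiff.1 ha (r - (r + s - t) / 2) (by linarith)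
    obtain ⟨g, rfl, hg⟩ := hiff.1 hb (s - (r + s - t) / 2) (by linarith)
    refine ⟨f * g, map_mul _ _ _, fun k hk => ?_⟩
    obtain ⟨k₁, h₁, k₂, h₂, rfl⟩ := Finset.mem_add.1 (MvPolynomial.support_mul f g hk)
    have h₁ := hf _ h₁
    have h₂ := hg _ h₂
    simp only [Finsupp.add_apply, Nat.cast_add, add_mul, Finset.sum_add_distrib]
    linarith
  · intro a
    obtain ⟨f, rfl⟩ := hπ a
    obtain ⟨r, hr⟩ := (f.support.image fun k => -∑ i, (k i : ℝ) * d i).bddBelow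
    exact ⟨r, hle ⟨f, rfl, fun k hk => hr (Finset.mem_coe.2 (Finset.mem_image_of_mem _ hk))⟩⟩

end Admissible

theorem EReal.coe_le_natCast_add_coe_mul_iff {g e : ℝ} (he : 0 < e) (i : ℕ) (x : EReal) :
    (g : EReal) ≤ (i : EReal) + (e : EReal) * x ↔ (((g - i) / e : ℝ) : EReal) ≤ x := by
  induction x with
  | bot => simp [EReal.coe_mul_bot_of_pos he]
  | top =>
    rw [EReal.coe_mul_top_of_pos he, ← EReal.coe_natCast, EReal.coe_add_top]
    simp
  | coe x =>
    rw [← EReal.coe_natCast]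
    norm_cast
    rw [div_le_iff₀ he, sub_le_iff_le_add', mul_comm]

theorem RealFiltration.isOverconvergent_iff {A : Type*} [CommRing A] {τ : A → EReal}
    {F : RealFiltration A} (hF : ∀ (r : ℝ) (a : A), a ∈ F.N r ↔ (r : EReal) ≤ τ a)
    {p : ℕ} [hp : Fact p.Prime] [CharP A p] {α : WittVector p A} :
    IsOverconvergent p τ α ↔ α ∈ F.overconvergent p := by
  have hp0 : (0 : ℝ) < p := by exact_mod_cast hp.out.pos
  have key : ∀ {ε : ℝ} (hε : 0 < ε) (g : ℝ), (g : EReal) ≤ gaussNorm p τ ε α ↔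
      α ∈ F.gauss p ε⁻¹ (inv_nonneg.2 hε.le) g := by
    intro ε hε g
    rw [gaussNorm, le_iInf_iff, F.mem_gauss]
    refine forall_congr' fun i => ?_
    rw [hF, EReal.coe_le_natCast_add_coe_mul_iff (by positivity)]
    have : (g - i) / (ε * (p : ℝ) ^ (-(i : ℤ))) = ε⁻¹ * (g - i) * (p ^ i : ℕ) := by
      rw [zpow_neg, zpow_natCast]
      push_cast
      field_simp
    rw [this]
  constructor
  · rintro ⟨ε, hε, h⟩
    obtain ⟨g, -, hg⟩ := EReal.lt_iff_exists_real_btwn.1 (bot_lt_iff_ne_bot.2 h)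
    exact F.mem_overconvergent_of_mem_gauss ((key hε g).1 hg.le)
  · rintro ⟨c, hc, h⟩
    refine ⟨(c + 1)⁻¹, by positivity, ne_bot_of_le_ne_bot (EReal.coe_ne_bot (-c)) ?_⟩
    rw [key (by positivity)]
    exact F.gauss_le_gauss (by rw [inv_inv]; linarith) le_rfl (neg_nonpos.2 hc) h

/-- Hensel's lemma for overconvergent Witt vectors: Let `K` be a perfect
field of characteristic `p > 0` and `A` a finitely generated `K`-algebra with an
admissible pseudovaluation `τ`.  Let `f ∈ W(A)[T]` have overconvergent coefficients, and
let `f̄ ∈ A[T]` be obtained by applying `w₀` to the coefficients.  If `a ∈ A` satisfies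
`f̄(a) = 0` and `f̄'(a)` is a unit, then there is a unique overconvergent `α` with
`f(α) = 0` and `w₀(α) = a`. -/
theorem statement18 (p : ℕ) [Fact p.Prime] (K : Type*) [Field K] [CharP K p]
    [PerfectField K] (A : Type*) [CommRing A] [Algebra K A] [Algebra.FiniteType K A]
    (τ : A → EReal) (hτ : IsAdmissiblePV (trivialPV K) τ)
    (f : Polynomial (WittVector p A))
    (hf : ∀ i : ℕ, IsOverconvergent p τ (f.coeff i))
    (a : A)
    (ha : (f.map (WittVector.ghostComponent 0)).eval a = 0)
    (ha' : IsUnit ((Polynomial.derivative (f.map (WittVector.ghostComponent 0))).eval a)) :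
    ∃! α : WittVector p A,
      IsOverconvergent p τ α ∧ f.eval α = 0 ∧ α.coeff 0 = a := by
  have hgc : (WittVector.ghostComponent 0 : WittVector p A →+* A) = WittVector.constantCoeff := by
    ext x
    simp [WittVector.ghostComponent_apply, WittVector.constantCoeff]
  rw [hgc] at ha ha'
  rcases subsingleton_or_nontrivial A with hA | hA
  · have : Subsingleton (WittVector p A) := ⟨fun x y => WittVector.ext fun n =>
      Subsingleton.elim _ _⟩
    exact ⟨f.coeff 0, ⟨hf 0, Subsingleton.elim _ _, Subsingleton.elim _ _⟩,
      fun _ _ => Subsingleton.elim _ _⟩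
  have : CharP A p := charP_of_injective_algebraMap (algebraMap K A).injective p
  obtain ⟨F, hF⟩ := hτ.exists_realFiltration
  simp only [F.isOverconvergent_iff hF] at hf ⊢
  obtain ⟨x, hx, hfx, hxa⟩ := F.exists_overconvergent_root hf ha ha'
  refine ⟨x, ⟨hx, hfx, hxa⟩, fun y ⟨_, hfy, hya⟩ =>
    (WittVector.eq_of_eval_eq_zero_of_isUnit_derivative hfx hfy (hxa.trans hya.symm) ?_).symm⟩
  rw [Polynomial.derivative_map, ← hxa] at ha'
  change IsUnit (WittVector.constantCoeff _)
  rwa [← Polynomial.eval_map_apply]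
end
end
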